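/- Let $N\ge 3$, let $\Omega\subset\mathbb{R}^N$ be a bounded domain (nonempty, open, connected) with $C^\infty$ boundary, let $\nu$ be its outward unit normal, let $q\ge 1$ be a real number, and let $g\in C^1(\overline\Omega)$ be real-valued. Put $2^*=\frac{2N}{N-2}$. Suppose that the real-valued function $u\in C^1(\overline\Omega)\cap C^2(\Omega)$ satisfies \[ -\Delta u=|u|^{2^*-2}u+g\,|u|^{q-1}u\ \text{ in }\Omega,\qquad u=0\ \text{ on }\partial\Omega . \] Then the Pohozaev identity holds: \[ \int_\Omega\left\{\frac{x\cdot\nabla g(x)}{q+1}+\left(\frac{N}{q+1}-\frac{N-2}{2}\right)g(x)\right\}|u(x)|^{q+1}\,dx=\frac12\int_{\partial\Omega}(x\cdot\nu(x))\,|\nabla u(x)|^2\,d\sigma(x), \] where $\sigma$ is the surface measure on $\partial\Omega$, i.e. the $(N-1)$-dimensional Hausdorff measure normalized so that it agrees with Lebesgue measure on $\mathbb{R}^{N-1}$, and $\nabla u$ on $\partial\Omega$ is the continuous extension of $\nabla u$ from $\Omega$. In particular, if $\Omega=B$ is the open unit ball, then $x\cdot\nu=1$ on $\partial B$ and the right-hand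 side is $\frac12\int_{\partial B}|\nabla u|^2\,d\sigma$. -/

import Mathlib

open MeasureTheory Set Metric
open scoped ContDiff RealInnerProductSpace

/-- `ρ` is a smooth local defining function, on the open neighbourhood `U` of the point `p`, for the
set `Ω`: inside `U` the set `Ω` is exactly `{ρ < 0}`, and `∇ρ(p) ≠ 0`. -/
structure IsLocalDefiningFunction {N : ℕ} (Ω : Set (EuclideanSpace ℝ (Fin N)))
    (p : EuclideanSpace ℝ (Fin N)) (ρ : EuclideanSpace ℝ (Fin N) → ℝ)
    (U : Set (EuclideanSpace ℝ (Fin N))) : Prop where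
  isOpen : IsOpen U
  mem : p ∈ U
  smooth : ContDiffOn ℝ ∞ ρ U
  gradient_ne_zero : gradient ρ p ≠ 0
  inter_eq : Ω ∩ U = {x ∈ U | ρ x < 0}

/-- A bounded domain (nonempty, open, connected) of `ℝ^N` with `C^∞` boundary: near each of its
boundary points it lies on one side of a smooth hypersurface. -/
structure IsBoundedSmoothDomain {N : ℕ} (Ω : Set (EuclideanSpace ℝ (Fin N))) : Prop where
  isOpen : IsOpen Ω
  isConnected : IsConnected Ω
  isBounded : Bornology.IsBounded Ω
  smooth_boundary : ∀ p ∈ frontier Ω, ∃ ρ U, IsLocalDefiningFunction Ω p ρ U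

open Classical in
/-- The outward unit normal `ν(p) = ∇ρ(p) / |∇ρ(p)|` of `Ω` at a boundary point `p`, computed from
a local defining function `ρ` at `p`; it does not depend on `ρ`, see `outwardUnitNormal_eq`. (The
value is `0` if there is no local defining function at `p`.) -/
noncomputable def outwardUnitNormal {N : ℕ} (Ω : Set (EuclideanSpace ℝ (Fin N)))
    (p : EuclideanSpace ℝ (Fin N)) : EuclideanSpace ℝ (Fin N) :=
  if h : ∃ ρ U, IsLocalDefiningFunction Ω p ρ U then
    ‖gradient h.choose p‖⁻¹ • gradient h.choose p
  else 0

theorem IsLocalDefiningFunction.hasGradientAt {N : ℕ} {Ω U : Set (EuclideanSpace ℝ (Fin N))}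
    {p : EuclideanSpace ℝ (Fin N)} {ρ : EuclideanSpace ℝ (Fin N) → ℝ}
    (h : IsLocalDefiningFunction Ω p ρ U) : HasGradientAt ρ (gradient ρ p) p :=
  ((h.smooth.contDiffAt (h.isOpen.mem_nhds h.mem)).differentiableAt (by simp)).hasGradientAt

theorem IsLocalDefiningFunction.apply_eq_zero {N : ℕ} {Ω U : Set (EuclideanSpace ℝ (Fin N))}
    {p : EuclideanSpace ℝ (Fin N)} {ρ : EuclideanSpace ℝ (Fin N) → ℝ} (hΩ : IsOpen Ω)
    (hp : p ∈ frontier Ω) (h : IsLocalDefiningFunction Ω p ρ U) : ρ p = 0 := by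
  rw [hΩ.frontier_eq] at hp
  apply le_antisymm
  · by_contra! hlt
    have hc : ContinuousAt ρ p := h.hasGradientAt.continuousAt
    have h1 : ∀ᶠ x in nhds p, 0 < ρ x ∧ x ∈ U :=
      (hc.eventually (lt_mem_nhds hlt)).and (h.isOpen.mem_nhds h.mem)
    obtain ⟨x, ⟨hx1, hx2⟩, hx3⟩ := mem_closure_iff_nhds.1 hp.1 _ h1
    have : x ∈ Ω ∩ U := ⟨hx3, hx2⟩
    rw [h.inter_eq] at this
    exact absurd this.2 (not_lt.2 hx1.le)
  · by_contra! hlt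
    have : p ∈ Ω ∩ U := by rw [h.inter_eq]; exact ⟨h.mem, hlt⟩
    exact hp.2 this.1

theorem IsLocalDefiningFunction.normalized_gradient_eq {N : ℕ}
    {Ω U V : Set (EuclideanSpace ℝ (Fin N))} {p : EuclideanSpace ℝ (Fin N)}
    {ρ σ : EuclideanSpace ℝ (Fin N) → ℝ} (hΩ : IsOpen Ω) (hp : p ∈ frontier Ω)
    (hρ : IsLocalDefiningFunction Ω p ρ U) (hσ : IsLocalDefiningFunction Ω p σ V) :
    ‖gradient ρ p‖⁻¹ • gradient ρ p = ‖gradient σ p‖⁻¹ • gradient σ p := by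
  have line : ∀ (τ : EuclideanSpace ℝ (Fin N) → ℝ) (W : Set (EuclideanSpace ℝ (Fin N))),
      IsLocalDefiningFunction Ω p τ W → ∀ v : EuclideanSpace ℝ (Fin N),
      HasDerivAt (fun t : ℝ => τ (p + t • v)) ⟪gradient τ p, v⟫ 0 := by
    intro τ W hτ v
    have h1 : HasDerivAt (fun t : ℝ => p + t • v) v 0 := by
      simpa using ((hasDerivAt_id (0 : ℝ)).smul_const v).const_add p
    have h2 : HasFDerivAt τ (InnerProductSpace.toDual ℝ _ (gradient τ p)) (p + (0 : ℝ) • v) := by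
      simpa using hτ.hasGradientAt.hasFDerivAt
    have h3 := h2.comp_hasDerivAt (0 : ℝ) h1
    rw [InnerProductSpace.toDual_apply_apply] at h3
    exact h3
  have key : ∀ v : EuclideanSpace ℝ (Fin N), ⟪gradient ρ p, v⟫ < 0 → ⟪gradient σ p, v⟫ ≤ 0 := by
    intro v hv
    by_contra! hpos
    have e1 := (hasDerivAt_iff_tendsto_slope_zero.1 (line ρ U hρ v)).eventually (gt_mem_nhds hv)
    have e2 := (hasDerivAt_iff_tendsto_slope_zero.1 (line σ V hσ v)).eventually (lt_mem_nhds hpos)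
    have hcont : Filter.Tendsto (fun t : ℝ => p + t • v) (nhdsWithin 0 {0}ᶜ) (nhds p) := by
      have : Continuous (fun t : ℝ => p + t • v) := by fun_prop
      simpa using (this.tendsto 0).mono_left nhdsWithin_le_nhds
    have e3 := hcont.eventually (hρ.isOpen.mem_nhds hρ.mem)
    have e4 := hcont.eventually (hσ.isOpen.mem_nhds hσ.mem)
    have hle : nhdsWithin (0 : ℝ) (Ioi 0) ≤ nhdsWithin 0 {0}ᶜ :=
      nhdsWithin_mono _ (fun t (ht : 0 < t) => ht.ne')
    obtain ⟨t, ⟨⟨h1, h2⟩, h3, h4⟩, ht⟩ :=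
      ((((e1.and e2).and (e3.and e4)).filter_mono hle).and self_mem_nhdsWithin).exists
    have ht : 0 < t := ht
    simp only [zero_add, zero_smul, add_zero, smul_eq_mul, hρ.apply_eq_zero hΩ hp,
      hσ.apply_eq_zero hΩ hp, sub_zero] at h1 h2
    have hti : 0 < t⁻¹ := inv_pos.2 ht
    have hin : p + t • v ∈ Ω ∩ U := by
      rw [hρ.inter_eq]; exact ⟨h3, by nlinarith⟩
    have : p + t • v ∈ Ω ∩ V := ⟨hin.1, h4⟩
    rw [hσ.inter_eq] at this
    have := this.2
    nlinarith
  have ha := norm_pos_iff.2 hρ.gradient_ne_zero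
  have hb := norm_pos_iff.2 hσ.gradient_ne_zero
  generalize gradient ρ p = a at *
  generalize gradient σ p = b at *
  have hab : ⟪a, b⟫ = ‖a‖ * ‖b‖ := by
    apply le_antisymm (real_inner_le_norm a b)
    by_contra! hlt
    have h := key (‖a‖ • b - ‖b‖ • a) (by
      rw [inner_sub_right, inner_smul_right, inner_smul_right, real_inner_self_eq_norm_sq]
      nlinarith)
    rw [inner_sub_right, inner_smul_right, inner_smul_right, real_inner_self_eq_norm_sq,
      real_inner_comm] at h
    nlinarith
  have := (inner_eq_norm_mul_iff_real).1 hab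
  have h3 := congrArg (fun z => (‖a‖⁻¹ * ‖b‖⁻¹) • z) this
  simp only [smul_smul] at h3
  have ha' := ha.ne'
  have hb' := hb.ne'
  have c1 : ‖a‖⁻¹ * ‖b‖⁻¹ * ‖b‖ = ‖a‖⁻¹ := by field_simp
  have c2 : ‖a‖⁻¹ * ‖b‖⁻¹ * ‖a‖ = ‖b‖⁻¹ := by field_simp
  rwa [c1, c2] at h3

theorem outwardUnitNormal_eq {N : ℕ} {Ω U : Set (EuclideanSpace ℝ (Fin N))}
    {p : EuclideanSpace ℝ (Fin N)} {ρ : EuclideanSpace ℝ (Fin N) → ℝ} (hΩ : IsOpen Ω)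
    (hp : p ∈ frontier Ω) (h : IsLocalDefiningFunction Ω p ρ U) :
    outwardUnitNormal Ω p = ‖gradient ρ p‖⁻¹ • gradient ρ p := by
  have hex : ∃ ρ U, IsLocalDefiningFunction Ω p ρ U := ⟨ρ, U, h⟩
  rw [outwardUnitNormal, dif_pos hex]
  exact hex.choose_spec.choose_spec.normalized_gradient_eq hΩ hp h

/-- The critical Sobolev exponent `2* = 2N / (N - 2)`. -/
noncomputable def criticalExponent (N : ℕ) : ℝ := 2 * (N : ℝ) / ((N : ℝ) - 2)

open scoped NNReal ENNReal Topology
open Filter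

/-! ### The area formula for graphs -/

theorem euclideanHausdorffMeasure_image_le_of_edist_le {X Y Z : Type*} [EMetricSpace X]
    [EMetricSpace Y] [MeasurableSpace Y] [BorelSpace Y]
    [EMetricSpace Z] [MeasurableSpace Z] [BorelSpace Z] {f : X → Y} {g : X → Z} {A : Set X}
    {K : ℝ≥0} (d : ℕ) (h : ∀ x ∈ A, ∀ y ∈ A, edist (f x) (f y) ≤ K * edist (g x) (g y)) :
    (μHE[d] : Measure Y) (f '' A) ≤ (K : ℝ≥0∞) ^ d * (μHE[d] : Measure Z) (g '' A) := by
  rcases A.eq_empty_or_nonempty with rfl | ⟨a, ha⟩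
  · simp
  have : Nonempty X := ⟨a⟩
  set k : Z → X := Function.invFunOn g A
  have hk : ∀ z ∈ g '' A, k z ∈ A ∧ g (k z) = z := fun z hz =>
    ⟨Function.invFunOn_mem hz, Function.invFunOn_eq hz⟩
  have hL : LipschitzOnWith K (f ∘ k) (g '' A) := by
    intro z hz w hw
    have := h _ (hk z hz).1 _ (hk w hw).1
    rwa [(hk z hz).2, (hk w hw).2] at this
  have him : f '' A = (f ∘ k) '' (g '' A) := by
    rw [image_image]
    refine image_congr fun x hx => ?_
    have hgx := hk (g x) (mem_image_of_mem g hx)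
    have := h _ hx _ hgx.1
    rw [hgx.2, edist_self, mul_zero, nonpos_iff_eq_zero, edist_eq_zero] at this
    exact this
  have := hL.hausdorffMeasure_image_le (d := d) (by positivity)
  rw [him]
  simp only [Measure.euclideanHausdorffMeasure_def, Measure.smul_apply]
  rw [ENNReal.smul_def, smul_eq_mul, ENNReal.smul_def, smul_eq_mul, mul_left_comm]
  rw [ENNReal.rpow_natCast] at this
  gcongr

theorem exists_clm_norm_sq_eq_add_inner_sq {V : Type*} [NormedAddCommGroup V]
    [InnerProductSpace ℝ V] [FiniteDimensional ℝ V] (a : V) :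
    ∃ L : V →L[ℝ] V, LinearMap.det (L : V →ₗ[ℝ] V) = √(1 + ‖a‖ ^ 2) ∧
      ∀ v, ‖L v‖ ^ 2 = ‖v‖ ^ 2 + ⟪a, v⟫ ^ 2 := by
  set J := √(1 + ‖a‖ ^ 2) with hJ
  have hJ2 : J ^ 2 = 1 + ‖a‖ ^ 2 := Real.sq_sqrt (by positivity)
  have hJ0 : 0 ≤ J := Real.sqrt_nonneg _
  set c := (J + 1)⁻¹ with hc
  have hcJ : c * (J + 1) = 1 := inv_mul_cancel₀ (by positivity)
  refine ⟨LinearMap.toContinuousLinearMap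
    (LinearMap.transvection (innerₛₗ ℝ a) (c • a)), ?_, fun v => ?_⟩
  · have := LinearMap.transvection.det (innerₛₗ ℝ a : V →ₗ[ℝ] ℝ) (c • a)
    simp only [LinearMap.coe_toContinuousLinearMap]
    rw [this]
    simp only [innerₛₗ_apply_apply, inner_smul_right, real_inner_self_eq_norm_sq]
    linear_combination (J - 1) * hcJ - c * hJ2
  · have : (LinearMap.toContinuousLinearMap (LinearMap.transvection (innerₛₗ ℝ a) (c • a))) v
        = v + ⟪a, v⟫ • c • a := rfl
    rw [this, norm_add_sq_real, norm_smul, norm_smul, inner_smul_right, inner_smul_right,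
      mul_pow, mul_pow, Real.norm_eq_abs, Real.norm_eq_abs, sq_abs, sq_abs, real_inner_comm a v]
    linear_combination ⟪a, v⟫ ^ 2 * (c * J + 1 - c) * hcJ - ⟪a, v⟫ ^ 2 * c ^ 2 * hJ2

section Graph

variable {n m : ℕ} {ψ : EuclideanSpace ℝ (Fin n) → ℝ}
  {φ : EuclideanSpace ℝ (Fin n) → EuclideanSpace ℝ (Fin m)}

theorem graph_near_linear (hψ : ContDiff ℝ 1 ψ)
    (hφ : ∀ y z, dist (φ y) (φ z) ^ 2 = ‖y - z‖ ^ 2 + (ψ y - ψ z) ^ 2)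
    (y₀ : EuclideanSpace ℝ (Fin n))
    {L : EuclideanSpace ℝ (Fin n) →L[ℝ] EuclideanSpace ℝ (Fin n)}
    (hL : ∀ v, ‖L v‖ ^ 2 = ‖v‖ ^ 2 + ⟪gradient ψ y₀, v⟫ ^ 2) {K : ℝ≥0} (hK : 1 < K) :
    ∃ S ∈ 𝓝 y₀, ∀ y ∈ S, ∀ z ∈ S, edist (φ y) (φ z) ≤ K * edist (L y) (L z) ∧
      edist (L y) (L z) ≤ K * edist (φ y) (φ z) := by
  have hK' : (1 : ℝ) < K := by exact_mod_cast hK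
  have hK0 : (0 : ℝ) < K := by linarith
  set c : ℝ≥0 := (K - 1) / K with hc
  have hcr : (c : ℝ) = (K - 1) / K := by rw [hc, NNReal.coe_div, NNReal.coe_sub hK.le]; simp
  have hcpos : (0 : ℝ) < c := by rw [hcr]; exact div_pos (by linarith) hK0
  have hcK : (c : ℝ) * K = K - 1 := by rw [hcr]; field_simp
  obtain ⟨S, hS, hSa⟩ := (hψ.contDiffAt.hasStrictFDerivAt
    (x := y₀) (by norm_num)).approximates_deriv_on_nhds (c := c) (Or.inr (by exact_mod_cast hcpos))
  refine ⟨S, hS, fun y hy z hz => ?_⟩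
  have h1 := hSa y hy z hz
  rw [← inner_gradient_left, Real.norm_eq_abs] at h1
  have hLd : dist (L y) (L z) ^ 2 = ‖y - z‖ ^ 2 + ⟪gradient ψ y₀, y - z⟫ ^ 2 := by
    rw [dist_eq_norm, ← map_sub, hL]
  have hφd := hφ y z
  set p := ψ y - ψ z
  set r := ⟪gradient ψ y₀, y - z⟫
  set t := ‖y - z‖
  have ht : 0 ≤ t := norm_nonneg _
  set D := dist (φ y) (φ z) with hD
  set M := dist (L y) (L z) with hM
  have hD0 : 0 ≤ D := dist_nonneg
  have hM0 : 0 ≤ M := dist_nonneg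
  have htM : t ≤ M := by nlinarith [sq_nonneg r]
  have htri : ∀ (p r D M : ℝ), 0 ≤ D → 0 ≤ M → D ^ 2 = t ^ 2 + p ^ 2 → M ^ 2 = t ^ 2 + r ^ 2 →
      |p - r| ≤ c * t → D ≤ M + c * t := by
    intro p r D M hD0 hM0 h1 h2 h3
    have hct : 0 ≤ c * t := by positivity
    have hrM : |r| ≤ M := abs_le_of_sq_le_sq (by nlinarith [sq_nonneg t]) hM0
    refine le_of_sq_le_sq ?_ (by positivity)
    have e1 : (p - r) ^ 2 ≤ (c * t) ^ 2 := by
      rw [← sq_abs]; exact pow_le_pow_left₀ (abs_nonneg _) h3 2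
    have e2 : r * (p - r) ≤ M * (c * t) := by
      calc r * (p - r) ≤ |r * (p - r)| := le_abs_self _
        _ = |r| * |p - r| := abs_mul _ _
        _ ≤ M * (c * t) := mul_le_mul hrM h3 (abs_nonneg _) hM0
    nlinarith
  have hA : D ≤ M + c * t := htri p r D M hD0 hM0 hφd hLd h1
  have hB : M ≤ D + c * t := htri r p M D hM0 hD0 hLd hφd (by rwa [abs_sub_comm])
  have hctM : c * t ≤ c * M := by gcongr
  constructor
  · rw [edist_dist, edist_dist, ← ENNReal.ofReal_coe_nnreal, ← ENNReal.ofReal_mul hK0.le]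
    apply ENNReal.ofReal_le_ofReal
    nlinarith
  · rw [edist_dist, edist_dist, ← ENNReal.ofReal_coe_nnreal, ← ENNReal.ofReal_mul hK0.le]
    apply ENNReal.ofReal_le_ofReal
    nlinarith

theorem graph_measure_near (hψ : ContDiff ℝ 1 ψ)
    (hφ : ∀ y z, dist (φ y) (φ z) ^ 2 = ‖y - z‖ ^ 2 + (ψ y - ψ z) ^ 2)
    (y₀ : EuclideanSpace ℝ (Fin n)) {K : ℝ≥0} (hK : 1 < K) :
    ∃ S ∈ 𝓝 y₀, ∀ A ⊆ S,
      μHE[n] (φ '' A) ≤ (K : ℝ≥0∞) ^ n *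
        (ENNReal.ofReal √(1 + ‖gradient ψ y₀‖ ^ 2) * volume A) ∧
      ENNReal.ofReal √(1 + ‖gradient ψ y₀‖ ^ 2) * volume A ≤
        (K : ℝ≥0∞) ^ n * μHE[n] (φ '' A) := by
  obtain ⟨L, hdet, hL⟩ := exists_clm_norm_sq_eq_add_inner_sq (gradient ψ y₀)
  obtain ⟨S, hS, h⟩ := graph_near_linear hψ hφ y₀ hL hK
  refine ⟨S, hS, fun A hA => ?_⟩
  have hvol : ENNReal.ofReal √(1 + ‖gradient ψ y₀‖ ^ 2) * volume A = μHE[n] (L '' A) := by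
    rw [EuclideanSpace.euclideanHausdorffMeasure_eq_volume,
      Measure.addHaar_image_continuousLinearMap, hdet, abs_of_nonneg (Real.sqrt_nonneg _)]
  rw [hvol]
  exact ⟨euclideanHausdorffMeasure_image_le_of_edist_le n
      fun x hx y hy => (h x (hA hx) y (hA hy)).1,
    euclideanHausdorffMeasure_image_le_of_edist_le n
      fun x hx y hy => (h x (hA hx) y (hA hy)).2⟩

theorem isClosedEmbedding_graph (hψ : Continuous ψ)
    (hφ : ∀ y z, dist (φ y) (φ z) ^ 2 = ‖y - z‖ ^ 2 + (ψ y - ψ z) ^ 2) :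
    Topology.IsClosedEmbedding φ := by
  have hanti : AntilipschitzWith 1 φ := by
    refine AntilipschitzWith.of_le_mul_dist fun y z => ?_
    rw [NNReal.coe_one, one_mul]
    refine le_of_sq_le_sq ?_ dist_nonneg
    rw [hφ, dist_eq_norm]
    nlinarith [sq_nonneg (ψ y - ψ z)]
  have hcont : Continuous φ := by
    rw [continuous_iff_continuousAt]
    intro y
    rw [ContinuousAt, tendsto_iff_dist_tendsto_zero]
    have h0 : Tendsto (fun z => √(‖z - y‖ ^ 2 + (ψ z - ψ y) ^ 2)) (𝓝 y) (𝓝 0) := by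
      have : Continuous fun z => √(‖z - y‖ ^ 2 + (ψ z - ψ y) ^ 2) := by fun_prop
      simpa using this.tendsto y
    refine h0.congr fun z => ?_
    rw [← hφ, Real.sqrt_sq dist_nonneg]
  exact .of_continuous_injective_isClosedMap hcont hanti.injective
    (isProperMap_iff_tendsto_cocompact.2 ⟨hcont, by
      simpa only [Metric.cobounded_eq_cocompact] using hanti.tendsto_cobounded⟩).isClosedMap

theorem restrict_range_graph_eq (hψ : ContDiff ℝ 1 ψ)
    (hφ : ∀ y z, dist (φ y) (φ z) ^ 2 = ‖y - z‖ ^ 2 + (ψ y - ψ z) ^ 2) :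
    (μHE[n] : Measure (EuclideanSpace ℝ (Fin m))).restrict (range φ) =
      (volume.withDensity fun y => ENNReal.ofReal √(1 + ‖gradient ψ y‖ ^ 2)).map φ := by
  have hemb := (isClosedEmbedding_graph hψ.continuous hφ).measurableEmbedding
  rw [← hemb.map_comap]
  congr 1
  set ν := (μHE[n] : Measure (EuclideanSpace ℝ (Fin m))).comap φ with hν
  have hνa : ∀ A, ν A = μHE[n] (φ '' A) := fun A => hemb.comap_apply _ A
  have hloc : IsLocallyFiniteMeasure ν := by
    constructor
    intro y
    obtain ⟨S, hS, h⟩ := graph_measure_near hψ hφ y (K := 2) (by norm_num)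
    refine ⟨S ∩ ball y 1, inter_mem hS (ball_mem_nhds y one_pos), ?_⟩
    rw [hνa]
    refine (h _ inter_subset_left).1.trans_lt ?_
    refine ENNReal.mul_lt_top (by simp) (ENNReal.mul_lt_top (by simp) ?_)
    exact (measure_mono inter_subset_right).trans_lt measure_ball_lt_top
  have hac : ν ≪ volume := by
    intro A hA
    refine measure_null_of_locally_null A fun y _ => ?_
    obtain ⟨S, hS, h⟩ := graph_measure_near hψ hφ y (K := 2) (by norm_num)
    refine ⟨A ∩ S, inter_mem self_mem_nhdsWithin (mem_nhdsWithin_of_mem_nhds hS), ?_⟩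
    rw [hνa, ← nonpos_iff_eq_zero]
    refine (h _ inter_subset_right).1.trans ?_
    rw [measure_mono_null inter_subset_left hA]
    simp
  rw [← Measure.withDensity_rnDeriv_eq ν volume hac]
  refine withDensity_congr_ae ?_
  filter_upwards [Besicovitch.ae_tendsto_rnDeriv ν volume] with y hy
  have hpow : Tendsto (fun K : ℝ≥0 => (K : ℝ≥0∞) ^ n) (𝓝[>] 1) (𝓝 1) := by
    have : Continuous fun K : ℝ≥0 => ((K ^ n : ℝ≥0) : ℝ≥0∞) := by fun_prop
    have h := (this.tendsto 1).mono_left (nhdsWithin_le_nhds (s := Ioi 1))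
    simpa using h
  have hle : ∀ K : ℝ≥0, 1 < K →
      ν.rnDeriv volume y ≤ (K : ℝ≥0∞) ^ n * ENNReal.ofReal √(1 + ‖gradient ψ y‖ ^ 2) ∧
      ENNReal.ofReal √(1 + ‖gradient ψ y‖ ^ 2) ≤ (K : ℝ≥0∞) ^ n * ν.rnDeriv volume y := by
    intro K hK
    obtain ⟨S, hS, h⟩ := graph_measure_near hψ hφ y hK
    obtain ⟨δ, hδ, hδS⟩ := Metric.nhds_basis_closedBall.mem_iff.1 hS
    have hev : ∀ᶠ r in 𝓝[>] (0 : ℝ), 0 < r ∧ closedBall y r ⊆ S := by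
      filter_upwards [Ioc_mem_nhdsGT hδ] with r hr
      exact ⟨hr.1, (closedBall_subset_closedBall hr.2).trans hδS⟩
    constructor
    · refine le_of_tendsto hy ?_
      filter_upwards [hev] with r ⟨hr, hrS⟩
      have h0 := (measure_closedBall_pos volume y hr).ne'
      have h1 : volume (closedBall y r) ≠ ⊤ := measure_closedBall_lt_top.ne
      rw [ENNReal.div_le_iff h0 h1, hνa, mul_assoc]
      exact (h _ hrS).1
    · refine ge_of_tendsto (ENNReal.Tendsto.const_mul hy (Or.inr (by simp))) ?_
      filter_upwards [hev] with r ⟨hr, hrS⟩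
      have h0 := (measure_closedBall_pos volume y hr).ne'
      have h1 : volume (closedBall y r) ≠ ⊤ := measure_closedBall_lt_top.ne
      rw [← mul_div_assoc, ENNReal.le_div_iff_mul_le (Or.inl h0) (Or.inl h1), hνa]
      exact (h _ hrS).2
  have hle1 : ν.rnDeriv volume y ≤ ENNReal.ofReal √(1 + ‖gradient ψ y‖ ^ 2) := by
    have h1 := ENNReal.Tendsto.mul_const (b := ENNReal.ofReal √(1 + ‖gradient ψ y‖ ^ 2)) hpow
      (Or.inl one_ne_zero)
    rw [one_mul] at h1
    refine ge_of_tendsto h1 ?_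
    filter_upwards [self_mem_nhdsWithin] with K hK using (hle K hK).1
  refine le_antisymm hle1 ?_
  have h1 := ENNReal.Tendsto.mul_const (b := ν.rnDeriv volume y) hpow (Or.inl one_ne_zero)
  rw [one_mul] at h1
  refine ge_of_tendsto h1 ?_
  filter_upwards [self_mem_nhdsWithin] with K hK using (hle K hK).2

end Graph

/-! ### Splitting off one coordinate -/

/-- The map forgetting the `i`-th coordinate. -/
noncomputable def dropCoord {n : ℕ} (i : Fin (n + 1)) :
    EuclideanSpace ℝ (Fin (n + 1)) →L[ℝ] EuclideanSpace ℝ (Fin n) :=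
  LinearMap.toContinuousLinearMap
    { toFun := fun x => WithLp.toLp 2 fun j => x (i.succAbove j)
      map_add' := fun _ _ => rfl
      map_smul' := fun _ _ => rfl }

/-- The map inserting `0` as the `i`-th coordinate. -/
noncomputable def insertZero {n : ℕ} (i : Fin (n + 1)) :
    EuclideanSpace ℝ (Fin n) →L[ℝ] EuclideanSpace ℝ (Fin (n + 1)) :=
  LinearMap.toContinuousLinearMap
    { toFun := fun y => WithLp.toLp 2 (i.insertNth (0 : ℝ) y.ofLp : Fin (n + 1) → ℝ)
      map_add' := fun x y => by
        ext j
        refine Fin.succAboveCases i ?_ (fun j => ?_) j <;> simp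
      map_smul' := fun c y => by
        ext j
        refine Fin.succAboveCases i ?_ (fun j => ?_) j <;> simp }

/-- The `i`-th standard basis vector. -/
noncomputable abbrev basisVec {n : ℕ} (i : Fin (n + 1)) : EuclideanSpace ℝ (Fin (n + 1)) :=
  EuclideanSpace.single i (1 : ℝ)

section Coord

variable {n : ℕ} (i : Fin (n + 1))

@[simp] theorem dropCoord_apply (x : EuclideanSpace ℝ (Fin (n + 1))) (j : Fin n) :
    dropCoord i x j = x (i.succAbove j) := rfl

@[simp] theorem insertZero_apply_self (y : EuclideanSpace ℝ (Fin n)) : insertZero i y i = 0 := by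
  simp [insertZero]

@[simp] theorem insertZero_apply_succAbove (y : EuclideanSpace ℝ (Fin n)) (j : Fin n) :
    insertZero i y (i.succAbove j) = y j := by
  simp [insertZero]

@[simp] theorem dropCoord_insertZero (y : EuclideanSpace ℝ (Fin n)) :
    dropCoord i (insertZero i y) = y := by
  ext j; simp

@[simp] theorem dropCoord_basisVec : dropCoord i (basisVec i) = 0 := by
  ext j; simp [Fin.succAbove_ne]

theorem insertZero_dropCoord_add (x : EuclideanSpace ℝ (Fin (n + 1))) :
    insertZero i (dropCoord i x) + x i • basisVec i = x := by
  ext j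
  refine Fin.succAboveCases i ?_ (fun j => ?_) j <;> simp [Fin.succAbove_ne]

theorem inner_insertZero_add_insertZero_add (y z : EuclideanSpace ℝ (Fin n)) (s t : ℝ) :
    ⟪insertZero i y + s • basisVec i, insertZero i z + t • basisVec i⟫ = ⟪y, z⟫ + s * t := by
  simp only [PiLp.inner_apply, Fin.sum_univ_succAbove _ i]
  simp [Fin.succAbove_ne]
  ring

theorem norm_insertZero_add_sq (y : EuclideanSpace ℝ (Fin n)) (t : ℝ) :
    ‖insertZero i y + t • basisVec i‖ ^ 2 = ‖y‖ ^ 2 + t ^ 2 := by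
  rw [← real_inner_self_eq_norm_sq, inner_insertZero_add_insertZero_add,
    real_inner_self_eq_norm_sq, sq t]

theorem insertZero_add_eq_toLp_insertNth (y : EuclideanSpace ℝ (Fin n)) (t : ℝ) :
    insertZero i y + t • basisVec i =
      WithLp.toLp 2 (i.insertNth t y.ofLp : Fin (n + 1) → ℝ) := by
  ext j
  refine Fin.succAboveCases i ?_ (fun j => ?_) j <;> simp [Fin.succAbove_ne]

end Coord

/-! ### The divergence and the half-space -/

/-- The divergence of a vector field. -/
noncomputable def divergence {N : ℕ}
    (F : EuclideanSpace ℝ (Fin N) → EuclideanSpace ℝ (Fin N)) (x : EuclideanSpace ℝ (Fin N)) : ℝ :=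
  LinearMap.trace ℝ (EuclideanSpace ℝ (Fin N)) (fderiv ℝ F x)

theorem divergence_eq_sum {N : ℕ}
    (F : EuclideanSpace ℝ (Fin N) → EuclideanSpace ℝ (Fin N)) (x : EuclideanSpace ℝ (Fin N)) :
    divergence F x = ∑ j, fderiv ℝ F x (EuclideanSpace.single j 1) j := by
  rw [divergence, LinearMap.trace_eq_sum_inner _ (EuclideanSpace.basisFun (Fin N) ℝ)]
  simp [EuclideanSpace.inner_single_left]

theorem divergence_eq_zero_of_eventually {N : ℕ}
    {F : EuclideanSpace ℝ (Fin N) → EuclideanSpace ℝ (Fin N)} {x : EuclideanSpace ℝ (Fin N)}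
    (h : ∀ᶠ z in 𝓝 x, F z = 0) : divergence F x = 0 := by
  have : F =ᶠ[𝓝 x] fun _ => 0 := h
  simp [divergence, this.fderiv_eq]

theorem integral_divergence_halfSpace {n : ℕ} (i : Fin (n + 1)) (c R : ℝ)
    {F : EuclideanSpace ℝ (Fin (n + 1)) → EuclideanSpace ℝ (Fin (n + 1))}
    (hcont : ContinuousOn F {x | x i ≤ c})
    (hdiff : ∀ x : EuclideanSpace ℝ (Fin (n + 1)), x i < c → DifferentiableAt ℝ F x)
    (hR : ∀ x, R ≤ ‖x‖ → F x = 0)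
    (hdivF : IntegrableOn (divergence F) {x | x i < c}) :
    ∫ x in {x : EuclideanSpace ℝ (Fin (n + 1)) | x i < c}, divergence F x =
      ∫ y : EuclideanSpace ℝ (Fin n), F (insertZero i y + c • basisVec i) i := by
  obtain ⟨r, hr⟩ : ∃ r, max R |c| < r := exists_gt _
  have hrR : R < r := (le_max_left _ _).trans_lt hr
  have hrc : |c| < r := (le_max_right _ _).trans_lt hr
  have hr0 : 0 < r := (abs_nonneg c).trans_lt hrc
  have hcoord : ∀ (x : EuclideanSpace ℝ (Fin (n + 1))) j, |x j| ≤ ‖x‖ := fun x j => by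
    simpa using PiLp.norm_apply_le x j
  set T : Set (Fin (n + 1) → ℝ) := {z | z i < c} with hT
  have hTm : MeasurableSet T := measurableSet_lt (measurable_pi_apply i) measurable_const
  set a : Fin (n + 1) → ℝ := fun _ => -r with ha
  set b : Fin (n + 1) → ℝ := Function.update (fun _ => r) i c with hb
  have hbi : b i = c := by simp [hb]
  have hbj : ∀ j, j ≠ i → b j = r := fun j hj => by simp [hb, hj]
  have hab : a ≤ b := by
    intro j
    by_cases hj : j = i
    · subst hj; rw [hbi]; exact (neg_lt_of_abs_lt hrc).le
    · rw [hbj j hj]; simp only [ha]; linarith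
  set e := (PiLp.continuousLinearEquiv 2 ℝ (fun _ : Fin (n + 1) => ℝ)) with he
  set f : (Fin (n + 1) → ℝ) → Fin (n + 1) → ℝ := fun z => (F (WithLp.toLp 2 z)).ofLp with hf
  set f' : (Fin (n + 1) → ℝ) → (Fin (n + 1) → ℝ) →L[ℝ] (Fin (n + 1) → ℝ) := fun z =>
    if z i < c then (e : _ →L[ℝ] _) ∘L fderiv ℝ F (WithLp.toLp 2 z) ∘L (e.symm : _ →L[ℝ] _) else 0
    with hf'
  set D : (Fin (n + 1) → ℝ) → ℝ := fun z => ∑ j, f' z (Pi.single j 1) j with hD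
  have hDT : D = T.indicator fun z => divergence F (WithLp.toLp 2 z) := by
    ext z
    by_cases hz : z i < c
    · rw [indicator_of_mem (show z ∈ T from hz), divergence_eq_sum, hD]
      simp only [hf', if_pos hz]
      rfl
    · rw [indicator_of_notMem (show z ∉ T from hz), hD]
      simp [hf', if_neg hz]
  have hbox : ∀ z, z ∉ Icc a b → D z = 0 := by
    intro z hz
    rw [hDT]
    by_cases hzT : z ∈ T
    · rw [indicator_of_mem hzT]
      apply divergence_eq_zero_of_eventually
      have hnorm : R < ‖WithLp.toLp 2 z‖ := by
        by_contra! hle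
        apply hz
        have hzj : ∀ j, |z j| ≤ R := fun j => (hcoord (WithLp.toLp 2 z) j).trans hle
        refine ⟨fun j => ?_, fun j => ?_⟩
        · have := neg_le_of_abs_le (hzj j)
          simp only [ha]; linarith
        · by_cases hj : j = i
          · subst hj; rw [hbi]; exact le_of_lt hzT
          · rw [hbj j hj]
            exact (le_of_abs_le (hzj j)).trans hrR.le
      filter_upwards [(isOpen_lt continuous_const continuous_norm).mem_nhds hnorm] with w hw
      exact hR w (le_of_lt hw)
    · rw [indicator_of_notMem hzT]
  have hpres := PiLp.volume_preserving_toLp (Fin (n + 1))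
  have hemb : MeasurableEmbedding (WithLp.toLp 2 : (Fin (n + 1) → ℝ) → _) :=
    (MeasurableEquiv.toLp 2 (Fin (n + 1) → ℝ)).measurableEmbedding
  have hDint : Integrable D := by
    rw [hDT, integrable_indicator_iff hTm]
    exact (hpres.integrableOn_comp_preimage hemb).2 hdivF
  have hlhs : ∫ x in {x : EuclideanSpace ℝ (Fin (n + 1)) | x i < c}, divergence F x
      = ∫ z in Icc a b, D z := by
    rw [setIntegral_eq_integral_of_forall_compl_eq_zero hbox, hDT, integral_indicator hTm]
    exact (hpres.setIntegral_preimage_emb hemb (divergence F) _).symm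
  have htoLp : Continuous (WithLp.toLp 2 : (Fin (n + 1) → ℝ) → EuclideanSpace ℝ (Fin (n + 1))) :=
    e.symm.continuous
  have hfc : ContinuousOn f (Icc a b) := by
    refine e.continuous.comp_continuousOn (hcont.comp htoLp.continuousOn fun z hz => ?_)
    have := hz.2 i
    rwa [hbi] at this
  have hfd : ∀ z ∈ (univ.pi fun j => Ioo (a j) (b j)) \ ∅, HasFDerivAt f (f' z) z := by
    rintro z ⟨hz, -⟩
    have hzi : z i < c := by simpa [hbi] using (hz i (mem_univ i)).2
    simp only [hf', if_pos hzi]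
    have h1 : HasFDerivAt F (fderiv ℝ F (e.symm z)) (e.symm z) :=
      (hdiff (e.symm z) hzi).hasFDerivAt
    exact e.hasFDerivAt.comp z (h1.comp z e.symm.hasFDerivAt)
  rw [hlhs, hD, integral_divergence_of_hasFDerivAt_off_countable a b hab f f' ∅ countable_empty hfc
    hfd hDint.integrableOn]
  have hface : ∀ (j : Fin (n + 1)) (t : ℝ) (x : Fin n → ℝ), r ≤ |t| →
      f (j.insertNth t x) = 0 := by
    intro j t x ht
    have : R ≤ ‖(WithLp.toLp 2 (j.insertNth t x : Fin (n + 1) → ℝ))‖ := by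
      refine (hrR.le.trans ht).trans ?_
      simpa using hcoord (WithLp.toLp 2 (j.insertNth t x : Fin (n + 1) → ℝ)) j
    simp only [hf, hR _ this]
    rfl
  rw [Finset.sum_eq_single i]
  · have hlow : ∀ x, f (i.insertNth (a i) x) = 0 := fun x => hface i _ x (by simp [ha, le_abs_self])
    simp only [hlow, Pi.zero_apply, integral_zero, sub_zero, hbi]
    have hpres' := PiLp.volume_preserving_toLp (Fin n)
    have hemb' : MeasurableEmbedding (WithLp.toLp 2 : (Fin n → ℝ) → _) :=
      (MeasurableEquiv.toLp 2 (Fin n → ℝ)).measurableEmbedding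
    rw [← hpres'.integral_comp hemb', setIntegral_eq_integral_of_forall_compl_eq_zero]
    · simp only [insertZero_add_eq_toLp_insertNth, hf]
    · intro x hx
      suffices R ≤ ‖(WithLp.toLp 2 (i.insertNth c x : Fin (n + 1) → ℝ))‖ by
        simp only [hf, hR _ this]; rfl
      by_contra! hlt
      apply hx
      have hxj : ∀ j, |x j| ≤ r := fun j => by
        have := hcoord (WithLp.toLp 2 (i.insertNth c x : Fin (n + 1) → ℝ)) (i.succAbove j)
        simp only [Fin.insertNth_apply_succAbove] at this
        linarith
      refine ⟨fun j => ?_, fun j => ?_⟩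
      · exact neg_le_of_abs_le (hxj j)
      · simp only [Function.comp_apply, hbj _ (Fin.succAbove_ne i j)]
        exact le_of_abs_le (hxj j)
  · intro j _ hj
    have h1 : ∀ x, f (j.insertNth (a j) x) = 0 := fun x => hface j _ x (by simp [ha, le_abs_self])
    have h2 : ∀ x, f (j.insertNth (b j) x) = 0 := fun x =>
      hface j _ x (by rw [hbj j hj]; exact le_abs_self r)
    simp [h1, h2]
  · simp

theorem integral_divergence_eq_zero {n : ℕ} {R : ℝ}
    {F : EuclideanSpace ℝ (Fin (n + 1)) → EuclideanSpace ℝ (Fin (n + 1))}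
    (hdiff : Differentiable ℝ F) (hR : ∀ x, R ≤ ‖x‖ → F x = 0)
    (hdivF : Integrable (divergence F)) : ∫ x, divergence F x = 0 := by
  obtain ⟨c, hc⟩ : ∃ c, max R 0 < c := exists_gt _
  have hRc : R < c := (le_max_left _ _).trans_lt hc
  have hcoord : ∀ (x : EuclideanSpace ℝ (Fin (n + 1))), |x 0| ≤ ‖x‖ := fun x => by
    simpa using PiLp.norm_apply_le x 0
  have h := integral_divergence_halfSpace 0 c R hdiff.continuous.continuousOn
    (fun x _ => hdiff x) hR hdivF.integrableOn
  rw [setIntegral_eq_integral_of_forall_compl_eq_zero] at h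
  · rw [h]
    refine integral_eq_zero_of_ae (Eventually.of_forall fun y => ?_)
    have : R ≤ ‖insertZero 0 y + c • basisVec (0 : Fin (n + 1))‖ := by
      refine le_trans ?_ (hcoord _)
      simpa using hRc.le.trans (le_abs_self c)
    simp only [hR _ this]
    rfl
  · intro x hx
    apply divergence_eq_zero_of_eventually
    have hx' : R < ‖x‖ := by
      have : c ≤ x 0 := not_lt.1 hx
      linarith [hcoord x, le_abs_self (x 0)]
    filter_upwards [(isOpen_lt continuous_const continuous_norm).mem_nhds hx'] with w hw
    exact hR w (le_of_lt hw)

/-! ### Graph charts of the boundary -/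

/-- In the open set `V` the set `Ω` lies on one side of the graph of a `C²` function `ψ` of the
coordinates other than the `i`-th one; the sign `s` says on which. -/
structure IsGraphChart {n : ℕ} (Ω : Set (EuclideanSpace ℝ (Fin (n + 1)))) (i : Fin (n + 1)) (s : ℝ)
    (ψ : EuclideanSpace ℝ (Fin n) → ℝ) (V : Set (EuclideanSpace ℝ (Fin (n + 1)))) : Prop where
  isOpen : IsOpen V
  sign_mul_self : s * s = 1
  contDiff : ContDiff ℝ 2 ψ
  mem_iff : ∀ x ∈ V, x ∈ Ω ↔ s * (x i - ψ (dropCoord i x)) < 0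
  normal_eq : ∀ x ∈ V, x ∈ frontier Ω → outwardUnitNormal Ω x =
    (s * (√(1 + ‖gradient ψ (dropCoord i x)‖ ^ 2))⁻¹) •
      (insertZero i (-gradient ψ (dropCoord i x)) + (1 : ℝ) • basisVec i)

theorem continuous_coord {N : ℕ} (i : Fin N) :
    Continuous fun x : EuclideanSpace ℝ (Fin N) => x i :=
  (EuclideanSpace.proj i : EuclideanSpace ℝ (Fin N) →L[ℝ] ℝ).continuous

theorem IsGraphChart.mem_frontier_iff {n : ℕ} {Ω : Set (EuclideanSpace ℝ (Fin (n + 1)))}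
    {i : Fin (n + 1)} {s : ℝ} {ψ : EuclideanSpace ℝ (Fin n) → ℝ}
    {V : Set (EuclideanSpace ℝ (Fin (n + 1)))} (hΩ : IsOpen Ω) (h : IsGraphChart Ω i s ψ V)
    {x : EuclideanSpace ℝ (Fin (n + 1))} (hx : x ∈ V) :
    x ∈ frontier Ω ↔ x i = ψ (dropCoord i x) := by
  have hψ := h.contDiff.continuous
  have hci := continuous_coord i
  have hcont : Continuous fun z : EuclideanSpace ℝ (Fin (n + 1)) =>
      s * (z i - ψ (dropCoord i z)) := by fun_prop
  have hs0 : s ≠ 0 := fun h0 => by simpa [h0] using h.sign_mul_self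
  rw [hΩ.frontier_eq]
  constructor
  · rintro ⟨hcl, hnot⟩
    rw [h.mem_iff x hx, not_lt] at hnot
    rcases hnot.eq_or_lt with h0 | hpos
    · have := (mul_eq_zero.1 h0.symm).resolve_left hs0
      linarith
    · obtain ⟨z, ⟨hz1, hz2⟩, hz3⟩ := mem_closure_iff_nhds.1 hcl _
        (inter_mem ((isOpen_lt continuous_const hcont).mem_nhds hpos) (h.isOpen.mem_nhds hx))
      rw [h.mem_iff z hz2] at hz3
      exact absurd hz3 (not_lt.2 (le_of_lt hz1))
  · intro heq
    refine ⟨?_, ?_⟩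
    · have hlim : Tendsto (fun t : ℝ => x - (t * s) • basisVec i) (𝓝[>] 0) (𝓝 x) := by
        have : Continuous fun t : ℝ => x - (t * s) • basisVec i := by fun_prop
        simpa using (this.tendsto 0).mono_left (nhdsWithin_le_nhds (s := Ioi 0))
      refine mem_closure_of_tendsto hlim ?_
      filter_upwards [hlim.eventually (h.isOpen.mem_nhds hx), self_mem_nhdsWithin] with t ht ht0
      rw [h.mem_iff _ ht]
      have ht0 : 0 < t := ht0
      simp only [map_sub, map_smul, dropCoord_basisVec, smul_zero, sub_zero, PiLp.sub_apply,
        PiLp.smul_apply, heq, smul_eq_mul, PiLp.single_apply, if_true]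
      have := h.sign_mul_self
      nlinarith
    · rw [h.mem_iff x hx, heq]; simp

theorem IsGraphChart.mem_closure_iff {n : ℕ} {Ω : Set (EuclideanSpace ℝ (Fin (n + 1)))}
    {i : Fin (n + 1)} {s : ℝ} {ψ : EuclideanSpace ℝ (Fin n) → ℝ}
    {V : Set (EuclideanSpace ℝ (Fin (n + 1)))} (hΩ : IsOpen Ω) (h : IsGraphChart Ω i s ψ V)
    {x : EuclideanSpace ℝ (Fin (n + 1))} (hx : x ∈ V) :
    x ∈ closure Ω ↔ s * (x i - ψ (dropCoord i x)) ≤ 0 := by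
  have hs0 : s ≠ 0 := fun h0 => by simpa [h0] using h.sign_mul_self
  rw [closure_eq_self_union_frontier, mem_union, h.mem_frontier_iff hΩ hx, h.mem_iff x hx,
    le_iff_lt_or_eq, mul_eq_zero, or_iff_right hs0, sub_eq_zero]

theorem exists_contDiff_eventuallyEq {V : Type*} [NormedAddCommGroup V] [InnerProductSpace ℝ V]
    [FiniteDimensional ℝ V] {f : V → ℝ} {x : V} (hf : ContDiffAt ℝ 2 f x) :
    ∃ g : V → ℝ, ContDiff ℝ 2 g ∧ g =ᶠ[𝓝 x] f := by
  have hev : ∀ᶠ y in 𝓝 x, ContDiffAt ℝ 2 f y := hf.eventually (by simp)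
  obtain ⟨δ, hδ, hball⟩ := Metric.eventually_nhds_iff_ball.1 hev
  let χ : ContDiffBump x := ⟨δ / 4, δ / 2, by positivity, by linarith⟩
  refine ⟨fun y => χ y * f y, ?_, ?_⟩
  · rw [contDiff_iff_contDiffAt]
    intro y
    by_cases hy : y ∈ ball x δ
    · exact χ.contDiffAt.mul (hball y hy)
    · have hy' : y ∉ tsupport χ := by
        rw [χ.tsupport_eq]
        intro h
        exact hy (closedBall_subset_ball (by change δ / 2 < δ; linarith) h)
      have : (fun z => χ z * f z) =ᶠ[𝓝 y] fun _ => 0 := by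
        filter_upwards [notMem_tsupport_iff_eventuallyEq.1 hy'] with z hz
        simp [hz]
      exact contDiffAt_const.congr_of_eventuallyEq this
  · filter_upwards [χ.eventuallyEq_one] with y hy
    simp [hy]

theorem exists_isGraphChart {n : ℕ} {Ω : Set (EuclideanSpace ℝ (Fin (n + 1)))} (hΩ : IsOpen Ω)
    {p : EuclideanSpace ℝ (Fin (n + 1))} (hp : p ∈ frontier Ω)
    {ρ : EuclideanSpace ℝ (Fin (n + 1)) → ℝ} {U : Set (EuclideanSpace ℝ (Fin (n + 1)))}
    (h : IsLocalDefiningFunction Ω p ρ U) :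
    ∃ i s ψ V, p ∈ V ∧ IsGraphChart Ω i s ψ V := by
  obtain ⟨i, hi⟩ : ∃ i, gradient ρ p i ≠ 0 := by
    by_contra! hall
    exact h.gradient_ne_zero (by ext j; simpa using hall j)
  have hρU : ∀ x ∈ U, ContDiffAt ℝ ∞ ρ x := fun x hx => h.smooth.contDiffAt (h.isOpen.mem_nhds hx)
  have hρd : ∀ x ∈ U, DifferentiableAt ℝ ρ x := fun x hx => (hρU x hx).differentiableAt (by simp)
  have hpart : ∀ x, fderiv ℝ ρ x (basisVec i) = gradient ρ x i := fun x => by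
    rw [← inner_gradient_left, EuclideanSpace.inner_single_right]; simp
  set s : ℝ := ((SignType.sign (gradient ρ p i) : SignType) : ℝ) with hs
  have hss : s * s = 1 := by
    rcases lt_or_gt_of_ne hi with h0 | h0
    · simp [hs, sign_neg h0]
    · simp [hs, sign_pos h0]
  have hsp : 0 < s * fderiv ℝ ρ p (basisVec i) := by
    rw [hpart, hs, sign_mul_self]
    exact abs_pos.2 hi
  set A : EuclideanSpace ℝ (Fin n) × ℝ →L[ℝ] EuclideanSpace ℝ (Fin (n + 1)) :=
    (insertZero i) ∘L ContinuousLinearMap.fst ℝ _ _ +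
      (ContinuousLinearMap.snd ℝ (EuclideanSpace ℝ (Fin n)) ℝ).smulRight (basisVec i) with hA
  have hAv : ∀ y t, A (y, t) = insertZero i y + t • basisVec i := fun y t => by simp [hA]
  set v : EuclideanSpace ℝ (Fin n) × ℝ := (dropCoord i p, p i) with hv
  have hAp : A v = p := by rw [hv, hAv, insertZero_dropCoord_add]
  have hf : ContDiffAt ℝ 2 (ρ ∘ A) v := by
    refine ContDiffAt.comp v ?_ A.contDiff.contDiffAt
    rw [hAp]
    exact contDiffAt_infty.1 (hρU p h.mem) 2
  have hfd : fderiv ℝ (ρ ∘ A) v = fderiv ℝ ρ p ∘L A := by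
    have h1 : HasFDerivAt ρ (fderiv ℝ ρ p) (A v) := by rw [hAp]; exact (hρd p h.mem).hasFDerivAt
    exact (h1.comp v A.hasFDerivAt).fderiv
  have hinv : (fderiv ℝ (ρ ∘ A) v ∘L .inr ℝ (EuclideanSpace ℝ (Fin n)) ℝ).IsInvertible := by
    refine ⟨ContinuousLinearEquiv.smulLeft (Units.mk0 (gradient ρ p i) hi), ?_⟩
    ext
    rw [hfd]
    simp only [ContinuousLinearMap.comp_apply, ContinuousLinearMap.inr_apply, hAv, map_zero,
      zero_add, one_smul, hpart]
    simp [Units.smul_def]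
  obtain ⟨ψ, hψ, hψeq⟩ := exists_contDiff_eventuallyEq
    (hf.contDiffAt_implicitFunction two_ne_zero hinv)
  have hiff := hf.eventually_apply_eq_iff_implicitFunction two_ne_zero hinv
  have hf0 : (ρ ∘ A) v = 0 := by
    simp only [Function.comp_apply, hAp]; exact h.apply_eq_zero hΩ hp
  set B : EuclideanSpace ℝ (Fin (n + 1)) → EuclideanSpace ℝ (Fin n) × ℝ :=
    fun x => (dropCoord i x, x i) with hB
  have hBc : Continuous B := (dropCoord i).continuous.prodMk (continuous_coord i)
  have hAB : ∀ x, A (B x) = x := fun x => by rw [hB, hAv, insertZero_dropCoord_add]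
  have hgood : ∀ᶠ x in 𝓝 p, x ∈ U ∧ 0 < s * fderiv ℝ ρ x (basisVec i) ∧
      (ρ x = 0 ↔ ψ (dropCoord i x) = x i) := by
    have e1 : ∀ᶠ x in 𝓝 p, x ∈ U := h.isOpen.mem_nhds h.mem
    have e2 : ∀ᶠ x in 𝓝 p, 0 < s * fderiv ℝ ρ x (basisVec i) := by
      have hc : ContinuousAt (fun x => s * fderiv ℝ ρ x (basisVec i)) p := by
        have := ((hρU p h.mem).continuousAt_fderiv (by simp))
        fun_prop
      exact hc.eventually (lt_mem_nhds hsp)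
    have e3 := (hBc.tendsto p).eventually hiff
    have e4 := ((dropCoord i).continuous.tendsto p).eventually hψeq
    filter_upwards [e1, e2, e3, e4] with x h1 h2 h3 h4
    refine ⟨h1, h2, ?_⟩
    rw [hf0, Function.comp_apply, hAB] at h3
    rw [h3, h4]
  obtain ⟨δ, hδ, hball⟩ := Metric.eventually_nhds_iff_ball.1 hgood
  set γ : EuclideanSpace ℝ (Fin (n + 1)) → EuclideanSpace ℝ (Fin (n + 1)) :=
    fun x => insertZero i (dropCoord i x) + ψ (dropCoord i x) • basisVec i with hγ
  have hγc : Continuous γ := by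
    have := hψ.continuous
    fun_prop
  have hγd : ∀ x, dropCoord i (γ x) = dropCoord i x := fun x => by simp [hγ]
  have hγi : ∀ x, γ x i = ψ (dropCoord i x) := fun x => by simp [hγ]
  have hγp : γ p = p := by
    have := (hball p (mem_ball_self hδ)).2.2.1 (h.apply_eq_zero hΩ hp)
    simp only [hγ, this, insertZero_dropCoord_add]
  have hγsub : ∀ x, x - γ x = (x i - ψ (dropCoord i x)) • basisVec i := fun x => by
    conv_lhs => rw [← insertZero_dropCoord_add i x]
    simp only [hγ, map_add, dropCoord_insertZero, map_smul, dropCoord_basisVec, smul_zero,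
      add_zero]
    rw [sub_smul]; abel
  have hγ0 : ∀ x, γ x ∈ ball p δ → ρ (γ x) = 0 := fun x hx =>
    (hball _ hx).2.2.2 (by rw [hγd, hγi])
  set V := ball p δ ∩ γ ⁻¹' ball p δ with hV
  have hVo : IsOpen V := isOpen_ball.inter (isOpen_ball.preimage hγc)
  have hΩV : ∀ x ∈ V, x ∈ Ω ↔ s * (x i - ψ (dropCoord i x)) < 0 := by
    rintro x ⟨hx, hx'⟩
    have hxU : x ∈ Ω ↔ ρ x < 0 := by
      have := Set.ext_iff.1 h.inter_eq x
      simpa [(hball x hx).1] using this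
    obtain ⟨z, hz, hzeq⟩ := domain_mvt (f := ρ) (f' := fderiv ℝ ρ) (s := ball p δ)
      (fun z hz => (hρd z (hball z hz).1).hasFDerivAt.hasFDerivWithinAt) (convex_ball p δ) hx' hx
    have hzb : z ∈ ball p δ := (convex_ball p δ).segment_subset hx' hx hz
    rw [hγ0 x hx', sub_zero, hγsub, map_smul, smul_eq_mul] at hzeq
    have hk := (hball z hzb).2.1
    rw [hxU, hzeq]
    set k := fderiv ℝ ρ z (basisVec i)
    set t := x i - ψ (dropCoord i x)
    have hst : t * k = (s * t) * (s * k) := by linear_combination (-(t * k)) * hss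
    rw [hst]
    exact ⟨fun h => neg_of_mul_neg_left h hk.le, fun h => mul_neg_of_neg_of_pos h hk⟩
  have hψd : ∀ y, DifferentiableAt ℝ ψ y := fun y => hψ.differentiable (by simp) y
  refine ⟨i, s, ψ, V, ⟨mem_ball_self hδ, by rw [mem_preimage, hγp]; exact mem_ball_self hδ⟩,
    hVo, hss, hψ, hΩV, ?_⟩
  rintro x ⟨hx, hx'⟩ hxf
  have hgx := hball x hx
  have hgx0 : gradient ρ x ≠ 0 := by
    intro h0
    have := hgx.2.1
    rw [hpart, h0] at this
    simp at this
  have hdef : IsLocalDefiningFunction Ω x ρ U := ⟨h.isOpen, hgx.1, h.smooth, hgx0, h.inter_eq⟩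
  have hρx := hdef.apply_eq_zero hΩ hxf
  have hxγ : γ x = x := by
    rw [← sub_eq_zero, ← neg_sub, hγsub, hgx.2.2.1 hρx]; simp
  set y := dropCoord i x with hy
  set a := gradient ψ y with ha
  set k := fderiv ℝ ρ x (basisVec i) with hk
  have htan : ∀ w, ⟪gradient ρ x, insertZero i w⟫ = -(k * ⟪a, w⟫) := by
    intro w
    have hinner : HasFDerivAt (fun z => insertZero i z + ψ z • basisVec i)
        (insertZero i + (fderiv ℝ ψ y).smulRight (basisVec i)) y :=
      (insertZero i).hasFDerivAt.add ((hψd y).hasFDerivAt.smul_const (basisVec i))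
    have hout : HasFDerivAt ρ (fderiv ℝ ρ x) (insertZero i y + ψ y • basisVec i) := by
      have : insertZero i y + ψ y • basisVec i = x := hxγ
      rw [this]; exact (hρd x hgx.1).hasFDerivAt
    have hcomp := hout.comp y hinner
    have hzero : (ρ ∘ fun z => insertZero i z + ψ z • basisVec i) =ᶠ[𝓝 y] fun _ => 0 := by
      have hc : Continuous fun z => insertZero i z + ψ z • basisVec i := by
        have := hψ.continuous
        fun_prop
      have : ∀ᶠ z in 𝓝 y, insertZero i z + ψ z • basisVec i ∈ ball p δ := by
        refine hc.continuousAt.eventually (isOpen_ball.mem_nhds ?_)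
        exact hx'
      filter_upwards [this] with z hz
      have := hγ0 (insertZero i z) (by simpa [hγ] using hz)
      simpa [hγ] using this
    have := hcomp.unique ((hasFDerivAt_const (0 : ℝ) y).congr_of_eventuallyEq hzero)
    have := congrArg (fun T => T w) this
    simp only [ContinuousLinearMap.comp_apply, add_apply,
      ContinuousLinearMap.smulRight_apply, map_add, map_smul, smul_eq_mul,
      zero_apply] at this
    rw [inner_gradient_left, ha, inner_gradient_left]
    linarith
  have hgrad : gradient ρ x = k • (insertZero i (-a) + (1 : ℝ) • basisVec i) := by
    have hki : ⟪gradient ρ x, basisVec i⟫ = k := by rw [inner_gradient_left]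
    refine ext_inner_right ℝ fun z => ?_
    conv_lhs => rw [← insertZero_dropCoord_add i z]
    conv_rhs => rw [← insertZero_dropCoord_add i z]
    rw [inner_add_right, inner_smul_right, htan, inner_smul_left,
      inner_insertZero_add_insertZero_add, inner_neg_left, hki]
    simp only [RCLike.conj_to_real]
    ring
  have hsk : 0 < s * k := hgx.2.1
  have hnorm : ‖gradient ρ x‖ = (s * k) * √(1 + ‖a‖ ^ 2) := by
    rw [hgrad, norm_smul]
    have : ‖insertZero i (-a) + (1 : ℝ) • basisVec i‖ = √(1 + ‖a‖ ^ 2) := by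
      rw [← Real.sqrt_sq (norm_nonneg (insertZero i (-a) + (1 : ℝ) • basisVec i)),
        norm_insertZero_add_sq, norm_neg, one_pow, add_comm]
    rw [this, Real.norm_eq_abs]
    congr 1
    rw [← abs_of_pos hsk, abs_mul]
    have : |s| = 1 := by
      have h1 : |s| * |s| = 1 := by rw [← abs_mul, hss, abs_one]
      nlinarith [abs_nonneg s]
    rw [this, one_mul]
  rw [outwardUnitNormal_eq hΩ hxf hdef, hnorm, hgrad, smul_smul]
  congr 1
  have hk0 : k ≠ 0 := fun h0 => by simp [h0] at hsk
  have hs0 : s ≠ 0 := fun h0 => by simp [h0] at hsk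
  have hJ : √(1 + ‖a‖ ^ 2) ≠ 0 := by positivity
  field_simp
  rw [sq, hss]

/-! ### The divergence theorem below a graph -/

theorem continuous_gradient_of_contDiff {V : Type*} [NormedAddCommGroup V] [InnerProductSpace ℝ V]
    [CompleteSpace V] {f : V → ℝ} (hf : ContDiff ℝ 1 f) : Continuous (gradient f) :=
  (InnerProductSpace.toDual ℝ V).symm.continuous.comp (hf.continuous_fderiv one_ne_zero)

section Graph

variable {n : ℕ} {i : Fin (n + 1)} {s : ℝ} {ψ : EuclideanSpace ℝ (Fin n) → ℝ}

theorem dist_graph_sq (y z : EuclideanSpace ℝ (Fin n)) :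
    dist (insertZero i y + ψ y • basisVec i) (insertZero i z + ψ z • basisVec i) ^ 2 =
      ‖y - z‖ ^ 2 + (ψ y - ψ z) ^ 2 := by
  rw [dist_eq_norm, ← norm_insertZero_add_sq i, map_sub, sub_smul]
  congr 2
  abel

theorem integrableOn_graph_iff (hψ : ContDiff ℝ 1 ψ) {k : EuclideanSpace ℝ (Fin (n + 1)) → ℝ} :
    IntegrableOn k (range fun y => insertZero i y + ψ y • basisVec i) μHE[n] ↔
      Integrable fun y => √(1 + ‖gradient ψ y‖ ^ 2) * k (insertZero i y + ψ y • basisVec i) := by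
  have hφ := dist_graph_sq (i := i) (ψ := ψ)
  have hemb := (isClosedEmbedding_graph hψ.continuous hφ).measurableEmbedding
  have hm : Measurable fun y => Real.toNNReal √(1 + ‖gradient ψ y‖ ^ 2) := by
    have := continuous_gradient_of_contDiff hψ
    exact Continuous.measurable (by fun_prop)
  rw [IntegrableOn, restrict_range_graph_eq hψ hφ, hemb.integrable_map_iff]
  refine (integrable_withDensity_iff_integrable_smul hm).trans ?_
  simp only [NNReal.smul_def, Real.coe_toNNReal _ (Real.sqrt_nonneg _), smul_eq_mul,
    Function.comp_apply]

theorem setIntegral_graph (hψ : ContDiff ℝ 1 ψ) (k : EuclideanSpace ℝ (Fin (n + 1)) → ℝ) :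
    ∫ x in range (fun y => insertZero i y + ψ y • basisVec i), k x ∂μHE[n] =
      ∫ y, √(1 + ‖gradient ψ y‖ ^ 2) * k (insertZero i y + ψ y • basisVec i) := by
  have hφ := dist_graph_sq (i := i) (ψ := ψ)
  have hemb := (isClosedEmbedding_graph hψ.continuous hφ).measurableEmbedding
  have hm : Measurable fun y => Real.toNNReal √(1 + ‖gradient ψ y‖ ^ 2) := by
    have := continuous_gradient_of_contDiff hψ
    exact Continuous.measurable (by fun_prop)
  rw [restrict_range_graph_eq hψ hφ, hemb.integral_map]
  refine (integral_withDensity_eq_integral_smul hm _).trans ?_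
  simp only [NNReal.smul_def, Real.coe_toNNReal _ (Real.sqrt_nonneg _), smul_eq_mul]

/-- The shear carrying the half-space `x i < 0` to the side `s` of the graph of `ψ`. -/
noncomputable def graphShear (i : Fin (n + 1)) (s : ℝ) (ψ : EuclideanSpace ℝ (Fin n) → ℝ)
    (z : EuclideanSpace ℝ (Fin (n + 1))) : EuclideanSpace ℝ (Fin (n + 1)) :=
  z + ((s - 1) * z i + ψ (dropCoord i z)) • basisVec i

/-- The derivative of `graphShear`, as a perturbation of the identity. -/
noncomputable def graphShearForm (i : Fin (n + 1)) (s : ℝ) (ψ : EuclideanSpace ℝ (Fin n) → ℝ)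
    (z : EuclideanSpace ℝ (Fin (n + 1))) : EuclideanSpace ℝ (Fin (n + 1)) →L[ℝ] ℝ :=
  (s - 1) • (EuclideanSpace.proj i : EuclideanSpace ℝ (Fin (n + 1)) →L[ℝ] ℝ) +
    fderiv ℝ ψ (dropCoord i z) ∘L dropCoord i

theorem graphShearForm_apply (z h : EuclideanSpace ℝ (Fin (n + 1))) :
    graphShearForm i s ψ z h = (s - 1) * h i + fderiv ℝ ψ (dropCoord i z) (dropCoord i h) := by
  simp [graphShearForm]

theorem hasFDerivAt_graphShear (hψ : Differentiable ℝ ψ) (z : EuclideanSpace ℝ (Fin (n + 1))) :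
    HasFDerivAt (graphShear i s ψ)
      (ContinuousLinearMap.id ℝ _ + (graphShearForm i s ψ z).smulRight (basisVec i)) z := by
  have h1 : HasFDerivAt (fun z : EuclideanSpace ℝ (Fin (n + 1)) => z i)
      (EuclideanSpace.proj i : EuclideanSpace ℝ (Fin (n + 1)) →L[ℝ] ℝ) z :=
    (EuclideanSpace.proj i : EuclideanSpace ℝ (Fin (n + 1)) →L[ℝ] ℝ).hasFDerivAt
  have h2 : HasFDerivAt (fun z => ψ (dropCoord i z))
      (fderiv ℝ ψ (dropCoord i z) ∘L dropCoord i) z :=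
    (hψ _).hasFDerivAt.comp z (dropCoord i).hasFDerivAt
  exact (hasFDerivAt_id z).add (((h1.const_mul (s - 1)).add h2).smul_const _)

theorem det_fderiv_graphShear (z : EuclideanSpace ℝ (Fin (n + 1))) :
    (ContinuousLinearMap.id ℝ _ + (graphShearForm i s ψ z).smulRight (basisVec i)).det = s := by
  have h : ((ContinuousLinearMap.id ℝ _ + (graphShearForm i s ψ z).smulRight (basisVec i) :
      _ →L[ℝ] _) : EuclideanSpace ℝ (Fin (n + 1)) →ₗ[ℝ] EuclideanSpace ℝ (Fin (n + 1))) =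
      LinearMap.transvection (graphShearForm i s ψ z : _ →ₗ[ℝ] ℝ) (basisVec i) := rfl
  rw [ContinuousLinearMap.det, h, LinearMap.transvection.det]
  simp only [ContinuousLinearMap.coe_coe, graphShearForm_apply, dropCoord_basisVec, map_zero]
  simp

@[simp] theorem dropCoord_graphShear (z : EuclideanSpace ℝ (Fin (n + 1))) :
    dropCoord i (graphShear i s ψ z) = dropCoord i z := by
  simp [graphShear]

@[simp] theorem graphShear_apply_self (z : EuclideanSpace ℝ (Fin (n + 1))) :
    graphShear i s ψ z i = s * z i + ψ (dropCoord i z) := by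
  simp [graphShear]; ring

theorem graphShear_graphShear (hs : s * s = 1) (z : EuclideanSpace ℝ (Fin (n + 1))) :
    graphShear i s (fun y => -(s * ψ y)) (graphShear i s ψ z) = z := by
  rw [← insertZero_dropCoord_add i z,
    ← insertZero_dropCoord_add i (graphShear i s (fun y => -(s * ψ y)) _)]
  congr 2
  · simp
  · simp only [graphShear_apply_self, dropCoord_graphShear, insertZero_dropCoord_add]
    linear_combination z i * hs

theorem graphShear_graphShear' (hs : s * s = 1) (x : EuclideanSpace ℝ (Fin (n + 1))) :
    graphShear i s ψ (graphShear i s (fun y => -(s * ψ y)) x) = x := by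
  rw [← insertZero_dropCoord_add i x, ← insertZero_dropCoord_add i (graphShear i s ψ _)]
  congr 2
  · simp
  · simp only [graphShear_apply_self, dropCoord_graphShear, insertZero_dropCoord_add]
    linear_combination (x i - ψ (dropCoord i x)) * hs

theorem continuous_graphShear (hψ : Continuous ψ) : Continuous (graphShear i s ψ) := by
  have := continuous_coord i
  unfold graphShear
  fun_prop

/-- The Piola transform of a vector field under `graphShear`. -/
noncomputable def graphPullback (i : Fin (n + 1)) (s : ℝ) (ψ : EuclideanSpace ℝ (Fin n) → ℝ)
    (F : EuclideanSpace ℝ (Fin (n + 1)) → EuclideanSpace ℝ (Fin (n + 1)))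
    (z : EuclideanSpace ℝ (Fin (n + 1))) : EuclideanSpace ℝ (Fin (n + 1)) :=
  F (graphShear i s ψ z) + ((s - 1) * F (graphShear i s ψ z) i -
    s * fderiv ℝ ψ (dropCoord i z) (dropCoord i (F (graphShear i s ψ z)))) • basisVec i

theorem graphPullback_differentiableAt_and_divergence (hs : s * s = 1) (hψ : ContDiff ℝ 2 ψ)
    {F : EuclideanSpace ℝ (Fin (n + 1)) → EuclideanSpace ℝ (Fin (n + 1))}
    {z : EuclideanSpace ℝ (Fin (n + 1))} (hF : DifferentiableAt ℝ F (graphShear i s ψ z)) :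
    DifferentiableAt ℝ (graphPullback i s ψ F) z ∧
      divergence (graphPullback i s ψ F) z = divergence F (graphShear i s ψ z) := by
  have hψ1 : Differentiable ℝ ψ := hψ.differentiable (by simp)
  set T := fderiv ℝ F (graphShear i s ψ z) with hT
  set ℓ := graphShearForm i s ψ z with hℓ
  set S := ContinuousLinearMap.id ℝ _ + ℓ.smulRight (basisVec i) with hS
  have hFS : HasFDerivAt (fun z => F (graphShear i s ψ z)) (T ∘L S) z :=
    hF.hasFDerivAt.comp z (hasFDerivAt_graphShear hψ1 z)
  set P : EuclideanSpace ℝ (Fin (n + 1)) →L[ℝ] ℝ := EuclideanSpace.proj i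
  have hi : HasFDerivAt (fun z => F (graphShear i s ψ z) i) (P ∘L (T ∘L S)) z :=
    P.hasFDerivAt.comp z hFS
  have hd : HasFDerivAt (fun z => dropCoord i (F (graphShear i s ψ z)))
      (dropCoord i ∘L (T ∘L S)) z :=
    (dropCoord i).hasFDerivAt.comp z hFS
  have hψ2 : DifferentiableAt ℝ (fderiv ℝ ψ) (dropCoord i z) :=
    ((hψ.fderiv_right (m := 1) (by norm_num)).differentiable (by simp)) _
  have hψd : HasFDerivAt (fun z => fderiv ℝ ψ (dropCoord i z))
      (fderiv ℝ (fderiv ℝ ψ) (dropCoord i z) ∘L dropCoord i) z :=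
    hψ2.hasFDerivAt.comp z (dropCoord i).hasFDerivAt
  have hκ := (hi.const_mul (s - 1)).sub ((hψd.clm_apply hd).const_mul s)
  have hG := hFS.add (hκ.smul_const (basisVec i))
  have hG' : HasFDerivAt (graphPullback i s ψ F) _ z := hG
  refine ⟨hG'.differentiableAt, ?_⟩
  have hSe : S (basisVec i) = s • basisVec i := by
    simp only [hS, add_apply, ContinuousLinearMap.coe_id', id_eq,
      ContinuousLinearMap.smulRight_apply, hℓ, graphShearForm_apply, dropCoord_basisVec, map_zero,
      add_zero]
    have h1 : (s - 1) * basisVec i i = s - 1 := by simp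
    rw [h1]
    module
  have hTS : LinearMap.trace ℝ _ ((T ∘L S : _ →L[ℝ] _) : EuclideanSpace ℝ (Fin (n + 1)) →ₗ[ℝ] _) =
      LinearMap.trace ℝ _ (T : EuclideanSpace ℝ (Fin (n + 1)) →ₗ[ℝ] _) + ℓ (T (basisVec i)) := by
    have : ((T ∘L S : _ →L[ℝ] _) : EuclideanSpace ℝ (Fin (n + 1)) →ₗ[ℝ] _) =
        (T : EuclideanSpace ℝ (Fin (n + 1)) →ₗ[ℝ] _) +
          (ℓ : EuclideanSpace ℝ (Fin (n + 1)) →ₗ[ℝ] ℝ).smulRight (T (basisVec i)) := by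
      ext1 h
      simp [hS]
    rw [this, map_add, LinearMap.trace_smulRight]
    rfl
  rw [divergence, hG'.fderiv, divergence, ContinuousLinearMap.toLinearMap_add, map_add, hTS,
    ContinuousLinearMap.coe_smulRight, LinearMap.trace_smulRight]
  simp only [ContinuousLinearMap.coe_coe, sub_apply, smul_apply,
    ContinuousLinearMap.comp_apply, add_apply, ContinuousLinearMap.flip_apply, hSe,
    dropCoord_basisVec, map_zero, map_smul, smul_eq_mul, zero_apply, add_zero, hℓ,
    graphShearForm_apply]
  have hP : P (T (basisVec i)) = T (basisVec i) i := rfl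
  rw [hP]
  linear_combination
    (T (basisVec i) i - fderiv ℝ ψ (dropCoord i z) (dropCoord i (T (basisVec i)))) * hs

end Graph

theorem integral_divergence_graphSide {n : ℕ} {i : Fin (n + 1)} {s : ℝ}
    {ψ : EuclideanSpace ℝ (Fin n) → ℝ} (hs : s * s = 1) (hψ : ContDiff ℝ 2 ψ)
    {F : EuclideanSpace ℝ (Fin (n + 1)) → EuclideanSpace ℝ (Fin (n + 1))}
    {K : Set (EuclideanSpace ℝ (Fin (n + 1)))} (hK : IsCompact K) (hF0 : ∀ x, x ∉ K → F x = 0)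
    (hcont : ContinuousOn F {x | s * (x i - ψ (dropCoord i x)) ≤ 0})
    (hdiff : ∀ x : EuclideanSpace ℝ (Fin (n + 1)),
      s * (x i - ψ (dropCoord i x)) < 0 → DifferentiableAt ℝ F x)
    (hdivF : IntegrableOn (divergence F) {x | s * (x i - ψ (dropCoord i x)) < 0}) :
    Integrable (fun y => s * ⟪F (insertZero i y + ψ y • basisVec i),
        insertZero i (-gradient ψ y) + (1 : ℝ) • basisVec i⟫) ∧
      ∫ x in {x | s * (x i - ψ (dropCoord i x)) < 0}, divergence F x =
        ∫ y, s * ⟪F (insertZero i y + ψ y • basisVec i),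
          insertZero i (-gradient ψ y) + (1 : ℝ) • basisVec i⟫ := by
  have hψc := hψ.continuous
  have hψd : Differentiable ℝ ψ := hψ.differentiable (by simp)
  set Φ := graphShear i s ψ with hΦ
  set Θ := graphShear i s (fun y => -(s * ψ y)) with hΘ
  have hΘc : Continuous Θ := continuous_graphShear (by fun_prop)
  have hΦc : Continuous Φ := continuous_graphShear hψc
  have hside : ∀ z, s * (Φ z i - ψ (dropCoord i (Φ z))) = z i := fun z => by
    rw [hΦ, graphShear_apply_self, dropCoord_graphShear]
    linear_combination z i * hs
  set Z : Set (EuclideanSpace ℝ (Fin (n + 1))) := {z | z i < 0} with hZ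
  have hZm : MeasurableSet Z := (isOpen_lt (continuous_coord i) continuous_const).measurableSet
  have himage : Φ '' Z = {x | s * (x i - ψ (dropCoord i x)) < 0} := by
    ext x
    constructor
    · rintro ⟨z, hz, rfl⟩
      change s * _ < 0
      rw [hside]
      exact hz
    · intro hx
      refine ⟨Θ x, ?_, graphShear_graphShear' hs x⟩
      have := hside (Θ x)
      rw [hΦ, hΘ, graphShear_graphShear' hs x] at this
      change Θ x i < 0
      rw [hΘ, ← this]
      exact hx
  have hinj : InjOn Φ Z := fun z _ w _ h => by
    rw [← graphShear_graphShear (i := i) (ψ := ψ) hs z,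
      ← graphShear_graphShear (i := i) (ψ := ψ) hs w]
    exact congrArg _ h
  have hder : ∀ z ∈ Z, HasFDerivWithinAt Φ
      (ContinuousLinearMap.id ℝ _ + (graphShearForm i s ψ z).smulRight (basisVec i)) Z z :=
    fun z _ => (hasFDerivAt_graphShear hψd z).hasFDerivWithinAt
  have hsabs : |s| = 1 := by
    have h1 : |s| * |s| = 1 := by rw [← abs_mul, hs, abs_one]
    nlinarith [abs_nonneg s]
  set G := graphPullback i s ψ F with hG
  have hdG : ∀ z : EuclideanSpace ℝ (Fin (n + 1)), z i < 0 →
      DifferentiableAt ℝ G z ∧ divergence G z = divergence F (Φ z) := fun z hz =>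
    graphPullback_differentiableAt_and_divergence hs hψ (hdiff _ (by rw [← hΦ, hside]; exact hz))
  have hGint : IntegrableOn (divergence G) Z := by
    rw [← himage, integrableOn_image_iff_integrableOn_abs_det_fderiv_smul volume hZm hder hinj]
      at hdivF
    refine hdivF.congr_fun (fun z hz => ?_) hZm
    simp only [det_fderiv_graphShear, hsabs, one_smul]
    exact (hdG z hz).2.symm
  have hvol : ∫ x in {x | s * (x i - ψ (dropCoord i x)) < 0}, divergence F x =
      ∫ z in Z, divergence G z := by
    rw [← himage, integral_image_eq_integral_abs_det_fderiv_smul volume hZm hder hinj]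
    refine setIntegral_congr_fun hZm fun z hz => ?_
    simp only [det_fderiv_graphShear, hsabs, one_smul]
    exact (hdG z hz).2.symm
  have hGc : ContinuousOn G {z | z i ≤ 0} := by
    have h1 : ContinuousOn (fun z => F (Φ z)) {z | z i ≤ 0} :=
      hcont.comp hΦc.continuousOn fun z hz => by
        change s * _ ≤ 0
        rw [hside]
        exact hz
    have h2 : Continuous fun z => fderiv ℝ ψ (dropCoord i z) :=
      (hψ.continuous_fderiv (by simp)).comp (dropCoord i).continuous
    have h3 : ContinuousOn (fun z => F (Φ z) i) {z | z i ≤ 0} :=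
      (continuous_coord i).comp_continuousOn h1
    have h4 : ContinuousOn (fun z => fderiv ℝ ψ (dropCoord i z) (dropCoord i (F (Φ z))))
        {z | z i ≤ 0} :=
      h2.continuousOn.clm_apply ((dropCoord i).continuous.comp_continuousOn h1)
    exact h1.add (((h3.const_mul (s - 1)).sub (h4.const_mul s)).smul continuousOn_const)
  obtain ⟨R, hR⟩ : ∃ R, ∀ x ∈ K, ‖Θ x‖ < R := by
    obtain ⟨R, hR⟩ := (hK.image hΘc).isBounded.exists_norm_le
    exact ⟨R + 1, fun x hx => (hR _ (mem_image_of_mem _ hx)).trans_lt (lt_add_one R)⟩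
  have hGR : ∀ z, R ≤ ‖z‖ → G z = 0 := by
    intro z hz
    have hzK : Φ z ∉ K := fun h => by
      have := hR _ h
      rw [hΘ, hΦ, graphShear_graphShear hs] at this
      linarith
    simp only [hG, graphPullback]
    rw [← hΦ, hF0 _ hzK]
    simp
  have hΦ0 : ∀ y, Φ (insertZero i y + (0 : ℝ) • basisVec i) =
      insertZero i y + ψ y • basisVec i := fun y => by
    simp [hΦ, graphShear]
  have hGi : ∀ y, G (insertZero i y + (0 : ℝ) • basisVec i) i =
      s * ⟪F (insertZero i y + ψ y • basisVec i),
        insertZero i (-gradient ψ y) + (1 : ℝ) • basisVec i⟫ := by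
    intro y
    have hdrop : dropCoord i (insertZero i y + (0 : ℝ) • basisVec i) = y := by simp
    simp only [hG, graphPullback]
    rw [← hΦ, hΦ0, hdrop]
    set w := F (insertZero i y + ψ y • basisVec i)
    have hin : ⟪w, insertZero i (-gradient ψ y) + (1 : ℝ) • basisVec i⟫ =
        w i - fderiv ℝ ψ y (dropCoord i w) := by
      conv_lhs => rw [← insertZero_dropCoord_add i w]
      rw [inner_insertZero_add_insertZero_add, inner_neg_right, real_inner_comm,
        inner_gradient_left]
      ring
    rw [hin]
    simp only [PiLp.add_apply, PiLp.smul_apply, PiLp.single_apply, if_true, smul_eq_mul, mul_one]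
    ring
  refine ⟨?_, ?_⟩
  · simp only [← hGi]
    refine Continuous.integrable_of_hasCompactSupport ?_ ?_
    · refine (continuous_coord i).comp (hGc.comp_continuous (by fun_prop) fun y => ?_)
      simp
    · refine HasCompactSupport.intro (isCompact_closedBall 0 R) fun y hy => ?_
      have hyR : R ≤ ‖insertZero i y + (0 : ℝ) • basisVec i‖ := by
        rw [mem_closedBall_zero_iff, not_le] at hy
        refine hy.le.trans (le_of_sq_le_sq ?_ (norm_nonneg _))
        rw [norm_insertZero_add_sq]
        simp
      simp only [hGR _ hyR]
      rfl
  · rw [hvol, integral_divergence_halfSpace i 0 R hGc (fun z hz => (hdG z hz).1) hGR hGint]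
    simp only [hGi]

theorem IsGraphChart.integral_divergence {n : ℕ} {Ω : Set (EuclideanSpace ℝ (Fin (n + 1)))}
    {i : Fin (n + 1)} {s : ℝ} {ψ : EuclideanSpace ℝ (Fin n) → ℝ}
    {V : Set (EuclideanSpace ℝ (Fin (n + 1)))} (hΩ : IsOpen Ω) (h : IsGraphChart Ω i s ψ V)
    {F : EuclideanSpace ℝ (Fin (n + 1)) → EuclideanSpace ℝ (Fin (n + 1))}
    {K : Set (EuclideanSpace ℝ (Fin (n + 1)))} (hK : IsCompact K) (hKV : K ⊆ V)
    (hF0 : ∀ x, x ∉ K → F x = 0) (hcont : ContinuousOn F (closure Ω))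
    (hdiff : ∀ x ∈ Ω, DifferentiableAt ℝ F x) (hdivF : IntegrableOn (divergence F) Ω) :
    IntegrableOn (fun x => ⟪F x, outwardUnitNormal Ω x⟫) (frontier Ω) μHE[n] ∧
      ∫ x in Ω, divergence F x =
        ∫ x in frontier Ω, ⟪F x, outwardUnitNormal Ω x⟫ ∂μHE[n] := by
  have hψc := h.contDiff.continuous
  have hψ1 : ContDiff ℝ 1 ψ := h.contDiff.of_le (by norm_num)
  have hci := continuous_coord i
  set H : Set (EuclideanSpace ℝ (Fin (n + 1))) := {x | s * (x i - ψ (dropCoord i x)) < 0} with hH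
  have hHm : MeasurableSet H :=
    (isOpen_lt (by fun_prop) continuous_const).measurableSet
  have hFev : ∀ x, x ∉ K → ∀ᶠ z in 𝓝 x, F z = 0 := fun x hx => by
    filter_upwards [hK.isClosed.isOpen_compl.mem_nhds hx] with z hz using hF0 z hz
  have hind : Ω.indicator (divergence F) = H.indicator (divergence F) := by
    ext x
    by_cases hx : x ∈ K
    · have : x ∈ Ω ↔ x ∈ H := h.mem_iff x (hKV hx)
      by_cases hxΩ : x ∈ Ω
      · rw [indicator_of_mem hxΩ, indicator_of_mem (this.1 hxΩ)]
      · rw [indicator_of_notMem hxΩ, indicator_of_notMem (fun hxH => hxΩ (this.2 hxH))]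
    · have := divergence_eq_zero_of_eventually (hFev x hx)
      rw [indicator_apply_eq_zero.2 fun _ => this, indicator_apply_eq_zero.2 fun _ => this]
  have hcontH : ContinuousOn F {x | s * (x i - ψ (dropCoord i x)) ≤ 0} := by
    intro x hx
    by_cases hxK : x ∈ K
    · have hxV := hKV hxK
      have hxc : x ∈ closure Ω := (h.mem_closure_iff hΩ hxV).2 hx
      refine ((hcont x hxc).mono_of_mem_nhdsWithin ?_)
      filter_upwards [self_mem_nhdsWithin, mem_nhdsWithin_of_mem_nhds (h.isOpen.mem_nhds hxV)]
        with z hz hzV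
      exact (h.mem_closure_iff hΩ hzV).2 hz
    · have : F =ᶠ[𝓝 x] fun _ => 0 := hFev x hxK
      exact (continuousAt_const.congr this.symm).continuousWithinAt
  have hdiffH : ∀ x : EuclideanSpace ℝ (Fin (n + 1)),
      s * (x i - ψ (dropCoord i x)) < 0 → DifferentiableAt ℝ F x := by
    intro x hx
    by_cases hxK : x ∈ K
    · exact hdiff x ((h.mem_iff x (hKV hxK)).2 hx)
    · have : F =ᶠ[𝓝 x] fun _ => 0 := hFev x hxK
      exact (differentiableAt_const _).congr_of_eventuallyEq this
  have hintH : IntegrableOn (divergence F) H := by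
    rw [← integrable_indicator_iff hHm, ← hind, integrable_indicator_iff hΩ.measurableSet]
    exact hdivF
  obtain ⟨h1, h2⟩ := integral_divergence_graphSide h.sign_mul_self h.contDiff hK hF0 hcontH hdiffH
    hintH
  set k : EuclideanSpace ℝ (Fin (n + 1)) → ℝ := fun x => ⟪F x, outwardUnitNormal Ω x⟫ with hk
  set S := range fun y => insertZero i y + ψ y • basisVec i with hS
  have hSm : MeasurableSet S :=
    (isClosedEmbedding_graph hψc (dist_graph_sq (i := i))).isClosed_range.measurableSet
  have hSmem : ∀ x, x ∈ S ↔ x i = ψ (dropCoord i x) := by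
    intro x
    constructor
    · rintro ⟨y, rfl⟩
      simp
    · intro hx
      exact ⟨dropCoord i x, by simp only [← hx, insertZero_dropCoord_add]⟩
  have hindk : (frontier Ω).indicator k = S.indicator k := by
    ext x
    by_cases hx : x ∈ K
    · have : x ∈ frontier Ω ↔ x ∈ S := (h.mem_frontier_iff hΩ (hKV hx)).trans (hSmem x).symm
      by_cases hxS : x ∈ S
      · rw [indicator_of_mem hxS, indicator_of_mem (this.2 hxS)]
      · rw [indicator_of_notMem hxS, indicator_of_notMem (fun hxΩ => hxS (this.1 hxΩ))]
    · have : k x = 0 := by simp only [hk, hF0 x hx, inner_zero_left]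
      rw [indicator_apply_eq_zero.2 fun _ => this, indicator_apply_eq_zero.2 fun _ => this]
  have hkφ : ∀ y, √(1 + ‖gradient ψ y‖ ^ 2) * k (insertZero i y + ψ y • basisVec i) =
      s * ⟪F (insertZero i y + ψ y • basisVec i),
        insertZero i (-gradient ψ y) + (1 : ℝ) • basisVec i⟫ := by
    intro y
    set x := insertZero i y + ψ y • basisVec i with hx
    have hdrop : dropCoord i x = y := by simp [hx]
    by_cases hxK : x ∈ K
    · have hxf : x ∈ frontier Ω := (h.mem_frontier_iff hΩ (hKV hxK)).2 ((hSmem x).1 ⟨y, rfl⟩)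
      have hJ : √(1 + ‖gradient ψ y‖ ^ 2) ≠ 0 := by positivity
      simp only [hk]
      rw [h.normal_eq x (hKV hxK) hxf, hdrop, inner_smul_right]
      field_simp
    · simp only [hk, hF0 x hxK, inner_zero_left, mul_zero]
  constructor
  · rw [← integrable_indicator_iff isClosed_frontier.measurableSet, hindk,
      integrable_indicator_iff hSm]
    exact (integrableOn_graph_iff hψ1).2 (by simpa only [hkφ] using h1)
  · rw [← integral_indicator hΩ.measurableSet, hind, integral_indicator hHm, h2,
      ← integral_indicator isClosed_frontier.measurableSet, hindk, integral_indicator hSm,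
      setIntegral_graph hψ1]
    simp only [hkφ]

/-! ### The divergence theorem on a smooth domain -/

theorem divergence_smul {N : ℕ} {χ : EuclideanSpace ℝ (Fin N) → ℝ}
    {F : EuclideanSpace ℝ (Fin N) → EuclideanSpace ℝ (Fin N)} {x : EuclideanSpace ℝ (Fin N)}
    (hχ : DifferentiableAt ℝ χ x) (hF : DifferentiableAt ℝ F x) :
    divergence (fun z => χ z • F z) x = χ x * divergence F x + fderiv ℝ χ x (F x) := by
  rw [divergence, fderiv_fun_smul hχ hF, divergence, ContinuousLinearMap.toLinearMap_add, map_add,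
    ContinuousLinearMap.toLinearMap_smul, map_smul, ContinuousLinearMap.coe_smulRight,
    LinearMap.trace_smulRight]
  rfl

theorem exists_isOpen_integral_divergence {n : ℕ} {Ω : Set (EuclideanSpace ℝ (Fin (n + 1)))}
    (hΩ : IsBoundedSmoothDomain Ω) {p : EuclideanSpace ℝ (Fin (n + 1))} (hp : p ∈ closure Ω) :
    ∃ V, IsOpen V ∧ p ∈ V ∧
      ∀ F : EuclideanSpace ℝ (Fin (n + 1)) → EuclideanSpace ℝ (Fin (n + 1)), ∀ K ⊆ V, IsCompact K →
        (∀ x, x ∉ K → F x = 0) → ContinuousOn F (closure Ω) →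
        (∀ x ∈ Ω, DifferentiableAt ℝ F x) → IntegrableOn (divergence F) Ω →
        IntegrableOn (fun x => ⟪F x, outwardUnitNormal Ω x⟫) (frontier Ω) μHE[n] ∧
          ∫ x in Ω, divergence F x =
            ∫ x in frontier Ω, ⟪F x, outwardUnitNormal Ω x⟫ ∂μHE[n] := by
  by_cases hpΩ : p ∈ Ω
  · refine ⟨Ω, hΩ.isOpen, hpΩ, fun F K hKΩ hK hF0 _ hdiff hdivF => ?_⟩
    have hFev : ∀ x, x ∉ K → ∀ᶠ z in 𝓝 x, F z = 0 := fun x hx => by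
      filter_upwards [hK.isClosed.isOpen_compl.mem_nhds hx] with z hz using hF0 z hz
    have hdiff' : Differentiable ℝ F := by
      intro x
      by_cases hxK : x ∈ K
      · exact hdiff x (hKΩ hxK)
      · have : F =ᶠ[𝓝 x] fun _ => 0 := hFev x hxK
        exact (differentiableAt_const _).congr_of_eventuallyEq this
    have hdiv0 : ∀ x, x ∉ Ω → divergence F x = 0 := fun x hx =>
      divergence_eq_zero_of_eventually (hFev x fun hxK => hx (hKΩ hxK))
    have hdivF' : Integrable (divergence F) :=
      (integrableOn_iff_integrable_of_support_subset
        (Function.support_subset_iff'.2 hdiv0)).1 hdivF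
    obtain ⟨R, hR⟩ := hK.isBounded.exists_norm_le
    have h0 : EqOn (fun x => ⟪F x, outwardUnitNormal Ω x⟫) (fun _ => 0) (frontier Ω) := by
      intro x hx
      have hxK : x ∉ K := fun hxK => by
        rw [hΩ.isOpen.frontier_eq] at hx
        exact hx.2 (hKΩ hxK)
      simp only [hF0 x hxK, inner_zero_left]
    refine ⟨integrableOn_zero.congr_fun h0.symm isClosed_frontier.measurableSet, ?_⟩
    rw [setIntegral_congr_fun isClosed_frontier.measurableSet h0, integral_zero,
      setIntegral_eq_integral_of_forall_compl_eq_zero hdiv0]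
    refine integral_divergence_eq_zero (R := R + 1) hdiff' (fun x hx => hF0 x fun hxK => ?_) hdivF'
    linarith [hR x hxK]
  · have hpf : p ∈ frontier Ω := by rw [hΩ.isOpen.frontier_eq]; exact ⟨hp, hpΩ⟩
    obtain ⟨ρ, U, hρ⟩ := hΩ.smooth_boundary p hpf
    obtain ⟨i, s, ψ, V, hpV, hV⟩ := exists_isGraphChart hΩ.isOpen hpf hρ
    exact ⟨V, hV.isOpen, hpV, fun F K hKV hK hF0 hcont hdiff hdivF =>
      hV.integral_divergence hΩ.isOpen hK hKV hF0 hcont hdiff hdivF⟩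

open scoped Manifold in
theorem integral_divergence_eq_integral_frontier {n : ℕ}
    {Ω : Set (EuclideanSpace ℝ (Fin (n + 1)))} (hΩ : IsBoundedSmoothDomain Ω)
    {F : EuclideanSpace ℝ (Fin (n + 1)) → EuclideanSpace ℝ (Fin (n + 1))}
    (hcont : ContinuousOn F (closure Ω)) (hdiff : ∀ x ∈ Ω, DifferentiableAt ℝ F x)
    (hdivF : IntegrableOn (divergence F) Ω) :
    ∫ x in Ω, divergence F x =
      ∫ x in frontier Ω, ⟪F x, outwardUnitNormal Ω x⟫ ∂μHE[n] := by
  have hcomp : IsCompact (closure Ω) := hΩ.isBounded.isCompact_closure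
  obtain ⟨R, hR⟩ : ∃ R, closure Ω ⊆ ball 0 R := by
    obtain ⟨R, hR⟩ := hcomp.isBounded.exists_norm_le
    exact ⟨R + 1, fun x hx => by
      rw [mem_ball_zero_iff]; exact (hR x hx).trans_lt (lt_add_one R)⟩
  choose! V hVo hpV hV using fun p (hp : p ∈ closure Ω) => exists_isOpen_integral_divergence hΩ hp
  obtain ⟨t, ht, hcover⟩ := hcomp.elim_nhds_subcover (fun p => V p ∩ ball 0 R) fun p hp =>
    inter_mem ((hVo p hp).mem_nhds (hpV p hp)) (isOpen_ball.mem_nhds (hR hp))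
  obtain ⟨f, hf⟩ := SmoothPartitionOfUnity.exists_isSubordinate 𝓘(ℝ, EuclideanSpace ℝ (Fin (n + 1)))
    isClosed_closure (fun p : t => V p ∩ ball 0 R)
    (fun p => (hVo p (ht p p.2)).inter isOpen_ball) (by simpa [iUnion_subtype] using hcover)
  have hfs : ∀ j, ContDiff ℝ ∞ (f j) := fun j => (f j).contMDiff.contDiff
  have hfd : ∀ j, Differentiable ℝ (f j) := fun j => (hfs j).differentiable (by simp)
  have hsum : ∀ x ∈ closure Ω, ∑ j, f j x = 1 := fun x hx => by
    rw [← finsum_eq_sum_of_fintype]; exact f.sum_eq_one hx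
  have hcoord : ∀ j, ContinuousOn (fun x => f j x • F x) (closure Ω) := fun j =>
    (hfs j).continuous.continuousOn.smul hcont
  have hd : ∀ j, ∀ x ∈ Ω, DifferentiableAt ℝ (fun x => f j x • F x) x := fun j x hx =>
    (hfd j x).smul (hdiff x hx)
  have hi : ∀ j, IntegrableOn (divergence fun x => f j x • F x) Ω := by
    intro j
    have h1 : IntegrableOn (fun x => f j x * divergence F x) Ω :=
      hdivF.continuousOn_mul_of_subset (hfs j).continuous.continuousOn hcomp
        hΩ.isOpen.measurableSet subset_closure
    have h2 : IntegrableOn (fun x => fderiv ℝ (f j) x (F x)) Ω :=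
      (((hfs j).continuous_fderiv (by simp)).continuousOn.clm_apply hcont
        |>.integrableOn_compact hcomp).mono_set subset_closure
    refine (h1.add h2).congr_fun (fun x hx => ?_) hΩ.isOpen.measurableSet
    exact (divergence_smul (hfd j x) (hdiff x hx)).symm
  have hloc := fun j : t => hV j (ht j j.2) (fun x => f j x • F x) (tsupport (f j))
    ((hf j).trans inter_subset_left)
    (isCompact_of_isClosed_isBounded (isClosed_tsupport _)
      (isBounded_ball.subset ((hf j).trans inter_subset_right)))
    (fun x hx => by simp only [image_eq_zero_of_notMem_tsupport hx, zero_smul])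
    (hcoord j) (hd j) (hi j)
  have hdivsum : ∀ x ∈ Ω, divergence F x = ∑ j, divergence (fun x => f j x • F x) x := by
    intro x hx
    have hev : F =ᶠ[𝓝 x] fun z => ∑ j, f j z • F z := by
      filter_upwards [hΩ.isOpen.mem_nhds hx] with z hz
      rw [← Finset.sum_smul, hsum z (subset_closure hz), one_smul]
    rw [divergence, hev.fderiv_eq, fderiv_fun_sum fun j _ => hd j x hx]
    simp only [divergence, ContinuousLinearMap.toLinearMap_sum, map_sum]
  rw [setIntegral_congr_fun hΩ.isOpen.measurableSet hdivsum, integral_finsetSum _ fun j _ => hi j]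
  have hbd : EqOn (fun x => ⟪F x, outwardUnitNormal Ω x⟫)
      (fun x => ∑ j, ⟪f j x • F x, outwardUnitNormal Ω x⟫) (frontier Ω) := by
    intro x hx
    simp only [← sum_inner]
    rw [← Finset.sum_smul, hsum x (frontier_subset_closure hx), one_smul]
  rw [setIntegral_congr_fun isClosed_frontier.measurableSet hbd,
    integral_finsetSum _ fun j _ => (hloc j).1]
  exact Finset.sum_congr rfl fun j _ => (hloc j).2

/-! ### Regularity up to the boundary -/

theorem IsBoundedSmoothDomain.uniqueDiffOn_closure {N : ℕ} {Ω : Set (EuclideanSpace ℝ (Fin N))}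
    (hΩ : IsBoundedSmoothDomain Ω) : UniqueDiffOn ℝ (closure Ω) := by
  intro x hx
  by_cases hxΩ : x ∈ Ω
  · exact (hΩ.isOpen.uniqueDiffWithinAt hxΩ).mono subset_closure
  have hxf : x ∈ frontier Ω := by rw [hΩ.isOpen.frontier_eq]; exact ⟨hx, hxΩ⟩
  obtain ⟨ρ, U, hρ⟩ := hΩ.smooth_boundary x hxf
  have hρ0 := hρ.apply_eq_zero hΩ.isOpen hxf
  set C : Set (EuclideanSpace ℝ (Fin N)) := {v | ⟪gradient ρ x, v⟫ < 0} with hC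
  have hCo : IsOpen C := isOpen_lt (by fun_prop) continuous_const
  have hsub : C ⊆ Submodule.span ℝ (tangentConeAt ℝ (closure Ω) x) := by
    intro v hv
    have hline : HasDerivAt (fun t : ℝ => x + t • v) v 0 := by
      simpa using ((hasDerivAt_id (0 : ℝ)).smul_const v).const_add x
    have hd : HasDerivAt (fun t : ℝ => ρ (x + t • v)) ⟪gradient ρ x, v⟫ 0 := by
      have h2 : HasFDerivAt ρ (InnerProductSpace.toDual ℝ _ (gradient ρ x)) (x + (0 : ℝ) • v) := by
        simpa using hρ.hasGradientAt.hasFDerivAt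
      have h3 := h2.comp_hasDerivAt (0 : ℝ) hline
      rwa [InnerProductSpace.toDual_apply_apply] at h3
    have hle : 𝓝[>] (0 : ℝ) ≤ 𝓝[≠] 0 := nhdsWithin_mono _ fun t (ht : 0 < t) => ht.ne'
    have e1 := ((hasDerivAt_iff_tendsto_slope_zero.1 hd).eventually (gt_mem_nhds hv)).filter_mono hle
    have hU : x + (0 : ℝ) • v ∈ U := by simpa using hρ.mem
    have e2 : ∀ᶠ t in 𝓝[>] (0 : ℝ), x + t • v ∈ U :=
      nhdsWithin_le_nhds (hline.continuousAt.eventually (hρ.isOpen.mem_nhds hU))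
    have e3 : ∀ᶠ t in 𝓝[>] (0 : ℝ), x + t • v ∈ Ω := by
      filter_upwards [e1, e2, self_mem_nhdsWithin] with t h1 h2 ht
      have ht : 0 < t := ht
      simp only [zero_add, zero_smul, add_zero, smul_eq_mul, hρ0, sub_zero] at h1
      have hti : 0 < t⁻¹ := inv_pos.2 ht
      have : x + t • v ∈ Ω ∩ U := by
        rw [hρ.inter_eq]; exact ⟨h2, by nlinarith⟩
      exact this.1
    obtain ⟨δ, hδ, hδs⟩ := mem_nhdsGT_iff_exists_Ioc_subset.1 e3
    have hδ : 0 < δ := hδ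
    have hseg : segment ℝ x (x + δ • v) ⊆ closure Ω := by
      rw [segment_eq_image']
      rintro _ ⟨θ, ⟨h0, h1⟩, rfl⟩
      simp only [add_sub_cancel_left, smul_smul]
      rcases h0.eq_or_lt with rfl | h0
      · simpa using hx
      · exact subset_closure (hδs ⟨by positivity, mul_le_of_le_one_left hδ.le h1⟩)
    have hmem := Submodule.subset_span (R := ℝ) (mem_tangentConeAt_of_segment_subset hseg)
    rw [add_sub_cancel_left] at hmem
    have := Submodule.smul_mem _ δ⁻¹ hmem
    rwa [smul_smul, inv_mul_cancel₀ hδ.ne', one_smul] at this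
  have htop : Submodule.span ℝ (tangentConeAt ℝ (closure Ω) x) = ⊤ := by
    refine Submodule.eq_top_of_nonempty_interior' _ ⟨-gradient ρ x, ?_⟩
    refine mem_interior.2 ⟨C, hsub, hCo, ?_⟩
    change ⟪gradient ρ x, -gradient ρ x⟫ < 0
    rw [inner_neg_right, real_inner_self_eq_norm_sq, neg_lt_zero]
    have := norm_pos_iff.2 hρ.gradient_ne_zero
    positivity
  refine ⟨by rw [htop]; exact dense_univ, subset_closure hx⟩

theorem ContDiffOn.continuousOn_gradientWithin {V : Type*} [NormedAddCommGroup V]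
    [InnerProductSpace ℝ V] [CompleteSpace V] {f : V → ℝ} {s : Set V} (hf : ContDiffOn ℝ 1 f s)
    (hs : UniqueDiffOn ℝ s) : ContinuousOn (gradientWithin f s) s :=
  (InnerProductSpace.toDual ℝ V).symm.continuous.comp_continuousOn
    (hf.continuousOn_fderivWithin hs le_rfl)

theorem gradientWithin_eq_gradient {V : Type*} [NormedAddCommGroup V]
    [InnerProductSpace ℝ V] [CompleteSpace V] {f : V → ℝ} {s : Set V} {x : V} (hs : s ∈ 𝓝 x) :
    gradientWithin f s x = gradient f x := by
  rw [gradientWithin, gradient, fderivWithin_of_mem_nhds hs]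

theorem norm_outwardUnitNormal {N : ℕ} {Ω : Set (EuclideanSpace ℝ (Fin N))}
    (hΩ : IsBoundedSmoothDomain Ω) {x : EuclideanSpace ℝ (Fin N)} (hx : x ∈ frontier Ω) :
    ‖outwardUnitNormal Ω x‖ = 1 := by
  obtain ⟨ρ, U, hρ⟩ := hΩ.smooth_boundary x hx
  rw [outwardUnitNormal_eq hΩ.isOpen hx hρ, norm_smul, norm_inv, norm_norm]
  exact inv_mul_cancel₀ (norm_ne_zero_iff.2 hρ.gradient_ne_zero)

theorem exists_gradientWithin_eq_smul_normal {n : ℕ} {Ω : Set (EuclideanSpace ℝ (Fin (n + 1)))}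
    (hΩ : IsBoundedSmoothDomain Ω) {u : EuclideanSpace ℝ (Fin (n + 1)) → ℝ}
    (hu : DifferentiableOn ℝ u (closure Ω)) (hu0 : ∀ x ∈ frontier Ω, u x = 0)
    {x : EuclideanSpace ℝ (Fin (n + 1))} (hx : x ∈ frontier Ω) :
    ∃ c : ℝ, gradientWithin u (closure Ω) x = c • outwardUnitNormal Ω x := by
  obtain ⟨ρ, U, hρ⟩ := hΩ.smooth_boundary x hx
  obtain ⟨i, s, ψ, V, hxV, hV⟩ := exists_isGraphChart hΩ.isOpen hx hρ
  set w := gradientWithin u (closure Ω) x with hw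
  set y := dropCoord i x with hy
  set a := gradient ψ y with ha
  have hψd : DifferentiableAt ℝ ψ y := hV.contDiff.differentiable (by simp) y
  have hxy : insertZero i y + ψ y • basisVec i = x := by
    rw [hy, ← (hV.mem_frontier_iff hΩ.isOpen hxV).1 hx, insertZero_dropCoord_add]
  have hinner : HasFDerivAt (fun z => insertZero i z + ψ z • basisVec i)
      (insertZero i + (fderiv ℝ ψ y).smulRight (basisVec i)) y :=
    (insertZero i).hasFDerivAt.add (hψd.hasFDerivAt.smul_const (basisVec i))
  have hfr : ∀ᶠ z in 𝓝 y, insertZero i z + ψ z • basisVec i ∈ frontier Ω := by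
    have : ∀ᶠ z in 𝓝 y, insertZero i z + ψ z • basisVec i ∈ V :=
      hinner.continuousAt.eventually (hV.isOpen.mem_nhds (by simpa only [hxy] using hxV))
    filter_upwards [this] with z hz
    rw [hV.mem_frontier_iff hΩ.isOpen hz]
    simp
  have htan : ∀ h, ⟪w, insertZero i h⟫ = -(⟪w, basisVec i⟫ * ⟪a, h⟫) := by
    intro h
    have hout : HasFDerivWithinAt u (fderivWithin ℝ u (closure Ω) x) (closure Ω)
        (insertZero i y + ψ y • basisVec i) := by
      rw [hxy]; exact (hu x (frontier_subset_closure hx)).hasFDerivWithinAt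
    have hcomp := hout.comp_hasFDerivAt y hinner
      (hfr.mono fun z hz => frontier_subset_closure hz)
    have hzero : (u ∘ fun z => insertZero i z + ψ z • basisVec i) =ᶠ[𝓝 y] fun _ => 0 :=
      hfr.mono fun z hz => hu0 _ hz
    have := hcomp.unique ((hasFDerivAt_const (0 : ℝ) y).congr_of_eventuallyEq hzero)
    have := congrArg (fun T => T h) this
    simp only [ContinuousLinearMap.comp_apply, add_apply,
      ContinuousLinearMap.smulRight_apply, map_add, map_smul, smul_eq_mul, zero_apply] at this
    rw [hw, inner_gradientWithin_left, inner_gradientWithin_left, ha, inner_gradient_left]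
    linarith
  have hgrad : w = ⟪w, basisVec i⟫ • (insertZero i (-a) + (1 : ℝ) • basisVec i) := by
    refine ext_inner_right ℝ fun z => ?_
    conv_lhs => rw [← insertZero_dropCoord_add i z]
    conv_rhs => rw [← insertZero_dropCoord_add i z]
    rw [inner_add_right, inner_smul_right, htan, inner_smul_left,
      inner_insertZero_add_insertZero_add, inner_neg_left]
    simp only [RCLike.conj_to_real]
    ring
  refine ⟨⟪w, basisVec i⟫ * (s * √(1 + ‖a‖ ^ 2)), ?_⟩
  rw [hV.normal_eq x hxV hx, smul_smul, ← hy, ← ha]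
  have hJ : √(1 + ‖a‖ ^ 2) * (√(1 + ‖a‖ ^ 2))⁻¹ = 1 := mul_inv_cancel₀ (by positivity)
  have : ⟪w, basisVec i⟫ * (s * √(1 + ‖a‖ ^ 2)) * (s * (√(1 + ‖a‖ ^ 2))⁻¹) = ⟪w, basisVec i⟫ := by
    linear_combination ⟪w, basisVec i⟫ * (s * s) * hJ + ⟪w, basisVec i⟫ * hV.sign_mul_self
  rw [this]
  exact hgrad

/-! ### The Pohozaev vector field -/

theorem divergence_id {N : ℕ} (x : EuclideanSpace ℝ (Fin N)) : divergence (fun z => z) x = N := by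
  simp [divergence_eq_sum]

theorem Filter.EventuallyEq.divergence_eq {N : ℕ}
    {F G : EuclideanSpace ℝ (Fin N) → EuclideanSpace ℝ (Fin N)} {x : EuclideanSpace ℝ (Fin N)}
    (h : F =ᶠ[𝓝 x] G) : divergence F x = divergence G x := by
  rw [divergence, divergence, h.fderiv_eq]

theorem hasFDerivAt_gradient {V : Type*} [NormedAddCommGroup V] [InnerProductSpace ℝ V]
    [CompleteSpace V] {u : V → ℝ} {x : V} (hu : ContDiffAt ℝ 2 u x) :
    ∃ A : V →L[ℝ] V, HasFDerivAt (gradient u) A x ∧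
      ∀ h k, ⟪A h, k⟫ = fderiv ℝ (fderiv ℝ u) x h k := by
  have h2 : DifferentiableAt ℝ (fderiv ℝ u) x :=
    (hu.fderiv_right (m := 1) (by norm_num)).differentiableAt (by simp)
  set D : StrongDual ℝ V →L[ℝ] V :=
    AddMonoidHom.toRealLinearMap (InnerProductSpace.toDual ℝ V).symm
      (InnerProductSpace.toDual ℝ V).symm.continuous with hD
  refine ⟨D ∘L fderiv ℝ (fderiv ℝ u) x, ?_, fun h k => ?_⟩
  · exact D.hasFDerivAt.comp x h2.hasFDerivAt
  · exact InnerProductSpace.toDual_symm_apply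

theorem divergence_gradient {N : ℕ} {u : EuclideanSpace ℝ (Fin N) → ℝ}
    {x : EuclideanSpace ℝ (Fin N)} (hu : ContDiffAt ℝ 2 u x) :
    divergence (gradient u) x = Laplacian.laplacian u x := by
  obtain ⟨A, hA, hAin⟩ := hasFDerivAt_gradient hu
  rw [divergence, hA.fderiv,
    LinearMap.trace_eq_sum_inner _ (EuclideanSpace.basisFun (Fin N) ℝ),
    InnerProductSpace.laplacian_eq_iteratedFDeriv_orthonormalBasis u
      (EuclideanSpace.basisFun (Fin N) ℝ)]
  refine Finset.sum_congr rfl fun j _ => ?_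
  rw [real_inner_comm, iteratedFDeriv_two_apply]
  exact hAin _ _

theorem divergence_pohozaev_field {N : ℕ} {u P : EuclideanSpace ℝ (Fin N) → ℝ}
    {x : EuclideanSpace ℝ (Fin N)} (hu : ContDiffAt ℝ 2 u x)
    {P' : EuclideanSpace ℝ (Fin N) →L[ℝ] ℝ} (hP : HasFDerivAt P P' x) :
    let F := fun z => (⟪z, gradient u z⟫ + ((N : ℝ) - 2) / 2 * u z) • gradient u z +
      (P z - 1 / 2 * ‖gradient u z‖ ^ 2) • z
    DifferentiableAt ℝ F x ∧ divergence F x =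
      (⟪x, gradient u x⟫ + ((N : ℝ) - 2) / 2 * u x) * Laplacian.laplacian u x +
        N * P x + P' x := by
  obtain ⟨A, hA, hAin⟩ := hasFDerivAt_gradient hu
  have hsymm : ∀ h k, ⟪A h, k⟫ = ⟪A k, h⟫ := fun h k => by
    rw [hAin, hAin]
    exact hu.isSymmSndFDerivAt (by simp) h k
  have hud : DifferentiableAt ℝ u x := hu.differentiableAt (by simp)
  have hα := ((hasFDerivAt_id x).inner ℝ hA).add (hud.hasFDerivAt.const_mul (((N : ℝ) - 2) / 2))
  have hβ := hP.sub ((hA.norm_sq).const_mul (1 / 2 : ℝ))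
  have hα' : HasFDerivAt (fun z => ⟪z, gradient u z⟫ + ((N : ℝ) - 2) / 2 * u z) _ x := hα
  have hβ' : HasFDerivAt (fun z => P z - 1 / 2 * ‖gradient u z‖ ^ 2) _ x := hβ
  have hid : DifferentiableAt ℝ (fun z : EuclideanSpace ℝ (Fin N) => z) x := differentiableAt_fun_id
  have d1 : DifferentiableAt ℝ (fun z => (⟪z, gradient u z⟫ + ((N : ℝ) - 2) / 2 * u z) •
      gradient u z) x := hα'.differentiableAt.smul hA.differentiableAt
  have d2 : DifferentiableAt ℝ (fun z => (P z - 1 / 2 * ‖gradient u z‖ ^ 2) • z) x :=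
    hβ'.differentiableAt.smul hid
  intro F
  refine ⟨d1.add d2, ?_⟩
  have hadd : divergence F x =
      divergence (fun z => (⟪z, gradient u z⟫ + ((N : ℝ) - 2) / 2 * u z) • gradient u z) x +
      divergence (fun z => (P z - 1 / 2 * ‖gradient u z‖ ^ 2) • z) x := by
    simp only [divergence, F]
    rw [fderiv_fun_add d1 d2, ContinuousLinearMap.toLinearMap_add, map_add]
  rw [hadd, divergence_smul hα'.differentiableAt hA.differentiableAt,
    divergence_smul hβ'.differentiableAt hid, divergence_gradient hu, divergence_id,
    hα'.fderiv, hβ'.fderiv]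
  simp only [add_apply, sub_apply, smul_apply, ContinuousLinearMap.comp_apply,
    ContinuousLinearMap.prod_apply, fderivInnerCLM_apply, ContinuousLinearMap.coe_id', id_eq,
    smul_eq_mul, innerSL_apply_apply, ← inner_gradient_left]
  have h1 : ⟪x, A (gradient u x)⟫ = ⟪gradient u x, A x⟫ := by
    rw [real_inner_comm, hsymm, real_inner_comm]
  rw [h1, real_inner_self_eq_norm_sq, nsmul_eq_mul]
  push_cast
  ring

theorem abs_rpow_eq_rpow_sub_two_mul_sq {r : ℝ} (hr : 0 < r) (t : ℝ) :
    |t| ^ r = |t| ^ (r - 2) * t ^ 2 := by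
  rcases eq_or_ne t 0 with rfl | ht
  · simp [Real.zero_rpow hr.ne']
  · have h := Real.rpow_add (abs_pos.2 ht) (r - 2) 2
    rw [sub_add_cancel] at h
    rw [h, Real.rpow_two, sq_abs]

/-- A primitive in `u` of the nonlinearity `|u|^{r-2} u + g |u|^{q-1} u`. -/
noncomputable def nonlinearPrimitive {N : ℕ} (r q : ℝ) (g u : EuclideanSpace ℝ (Fin N) → ℝ)
    (x : EuclideanSpace ℝ (Fin N)) : ℝ :=
  r⁻¹ * |u x| ^ r + (q + 1)⁻¹ * (g x * |u x| ^ (q + 1))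

theorem hasFDerivAt_nonlinearPrimitive {N : ℕ} {r q : ℝ} (hr : 1 < r) (hq : 1 ≤ q)
    {g u : EuclideanSpace ℝ (Fin N) → ℝ} {x : EuclideanSpace ℝ (Fin N)}
    (hg : DifferentiableAt ℝ g x) (hu : DifferentiableAt ℝ u x) :
    HasFDerivAt (nonlinearPrimitive r q g u)
      ((|u x| ^ (r - 2) * u x + g x * |u x| ^ (q - 1) * u x) • fderiv ℝ u x +
        ((q + 1)⁻¹ * |u x| ^ (q + 1)) • fderiv ℝ g x) x := by
  have h1 := ((hasDerivAt_abs_rpow (u x) hr).comp_hasFDerivAt x hu.hasFDerivAt).const_mul r⁻¹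
  have h2 := (hg.hasFDerivAt.mul ((hasDerivAt_abs_rpow (u x)
    (show 1 < q + 1 by linarith)).comp_hasFDerivAt x hu.hasFDerivAt)).const_mul (q + 1)⁻¹
  have hr0 : r ≠ 0 := by positivity
  have hq0 : q + 1 ≠ 0 := by positivity
  refine (h1.add h2).congr_fderiv ?_
  ext h
  have hexp : q + 1 - 2 = q - 1 := by ring
  simp only [add_apply, smul_apply, smul_eq_mul, Function.comp_apply, hexp]
  field_simp
  ring

theorem stmt_14 (N : ℕ) (hN : 3 ≤ N) (Ω : Set (EuclideanSpace ℝ (Fin N)))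
    (hΩ : IsBoundedSmoothDomain Ω) (q : ℝ) (hq : 1 ≤ q)
    (g u : EuclideanSpace ℝ (Fin N) → ℝ)
    (hg : ContDiffOn ℝ 1 g (closure Ω))
    (hu1 : ContDiffOn ℝ 1 u (closure Ω))
    (hu2 : ContDiffOn ℝ 2 u Ω)
    (hu0 : ∀ x ∈ frontier Ω, u x = 0)
    (hpde : ∀ x ∈ Ω,
      -(Laplacian.laplacian u x) = |u x| ^ (criticalExponent N - 2) * u x
        + g x * |u x| ^ (q - 1) * u x) :
    (∫ x in Ω,
        (⟪x, gradient g x⟫ / (q + 1)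
          + ((N : ℝ) / (q + 1) - ((N : ℝ) - 2) / 2) * g x) * |u x| ^ (q + 1))
      = (1 / 2) * ∫ x in frontier Ω,
          ⟪x, outwardUnitNormal Ω x⟫ * ‖gradientWithin u (closure Ω) x‖ ^ 2 ∂μHE[N - 1] := by
  obtain ⟨n, rfl⟩ : ∃ n, N = n + 1 := ⟨N - 1, by omega⟩
  rw [Nat.add_sub_cancel]
  have hN3 : (3 : ℝ) ≤ ((n + 1 : ℕ) : ℝ) := by exact_mod_cast hN
  set M : ℝ := ((n + 1 : ℕ) : ℝ) with hM
  set r := criticalExponent (n + 1) with hr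
  have hr_eq : r = 2 * M / (M - 2) := rfl
  have hM2 : 0 < M - 2 := by linarith
  have hr1 : 1 < r := by rw [hr_eq, lt_div_iff₀ hM2]; linarith
  have hMr : M * r⁻¹ = (M - 2) / 2 := by
    rw [hr_eq]
    have : M ≠ 0 := by positivity
    field_simp
  have hΩo := hΩ.isOpen
  have hmΩ := hΩo.measurableSet
  have huniq := hΩ.uniqueDiffOn_closure
  have hcomp : IsCompact (closure Ω) := hΩ.isBounded.isCompact_closure
  have hnhds : ∀ x ∈ Ω, closure Ω ∈ 𝓝 x := fun x hx =>
    mem_of_superset (hΩo.mem_nhds hx) subset_closure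
  set W := gradientWithin u (closure Ω) with hW
  have hWc : ContinuousOn W (closure Ω) := hu1.continuousOn_gradientWithin huniq
  have hgc : ContinuousOn (gradientWithin g (closure Ω)) (closure Ω) :=
    hg.continuousOn_gradientWithin huniq
  have huc := hu1.continuousOn
  have hpow : ∀ p : ℝ, 0 ≤ p → ContinuousOn (fun x => |u x| ^ p) (closure Ω) := fun p hp =>
    huc.abs.rpow_const fun _ _ => Or.inr hp
  set P := nonlinearPrimitive r q g u with hP
  have hPc : ContinuousOn P (closure Ω) :=
    ((hpow r (by linarith)).const_mul _).add
      ((hg.continuousOn.mul (hpow (q + 1) (by linarith))).const_mul _)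
  set F : EuclideanSpace ℝ (Fin (n + 1)) → EuclideanSpace ℝ (Fin (n + 1)) := fun z =>
    (⟪z, W z⟫ + (M - 2) / 2 * u z) • W z + (P z - 1 / 2 * ‖W z‖ ^ 2) • z with hF
  have hFc : ContinuousOn F (closure Ω) :=
    (((continuousOn_id.inner hWc).add (huc.const_mul _)).smul hWc).add
      ((hPc.sub ((hWc.norm.pow 2).const_mul _)).smul continuousOn_id)
  have hmain : ∀ x ∈ Ω, DifferentiableAt ℝ F x ∧ divergence F x =
      (⟪x, gradient g x⟫ / (q + 1) + (M / (q + 1) - (M - 2) / 2) * g x) * |u x| ^ (q + 1) := by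
    intro x hx
    have hu2x : ContDiffAt ℝ 2 u x := hu2.contDiffAt (hΩo.mem_nhds hx)
    have hgx : DifferentiableAt ℝ g x :=
      (hg.contDiffAt (hnhds x hx)).differentiableAt (by simp)
    obtain ⟨hd, hdiv⟩ := divergence_pohozaev_field hu2x
      (hasFDerivAt_nonlinearPrimitive hr1 hq hgx (hu2x.differentiableAt (by simp)))
    have hev : F =ᶠ[𝓝 x] fun z => (⟪z, gradient u z⟫ + (M - 2) / 2 * u z) • gradient u z +
        (P z - 1 / 2 * ‖gradient u z‖ ^ 2) • z := by
      filter_upwards [hΩo.mem_nhds hx] with z hz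
      simp only [hF, hW, gradientWithin_eq_gradient (hnhds z hz)]
    refine ⟨hd.congr_of_eventuallyEq hev, hev.divergence_eq.trans (hdiv.trans ?_)⟩
    have hΔ : Laplacian.laplacian u x = -(|u x| ^ (r - 2) * u x + g x * |u x| ^ (q - 1) * u x) := by
      rw [← hpde x hx, neg_neg]
    have hexp : q + 1 - 2 = q - 1 := by ring
    simp only [add_apply, smul_apply, smul_eq_mul, ← inner_gradient_left, nonlinearPrimitive]
    rw [real_inner_comm x (gradient u x), real_inner_comm x (gradient g x), hΔ,
      abs_rpow_eq_rpow_sub_two_mul_sq (show 0 < r by linarith) (u x),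
      abs_rpow_eq_rpow_sub_two_mul_sq (show 0 < q + 1 by linarith) (u x), hexp, ← hM]
    linear_combination |u x| ^ (r - 2) * u x ^ 2 * hMr
  have hdivF : IntegrableOn (divergence F) Ω := by
    have hc : ContinuousOn (fun x => (⟪x, gradientWithin g (closure Ω) x⟫ / (q + 1) +
        (M / (q + 1) - (M - 2) / 2) * g x) * |u x| ^ (q + 1)) (closure Ω) :=
      (((continuousOn_id.inner hgc).div_const _).add (hg.continuousOn.const_mul _)).mul
        (hpow (q + 1) (by linarith))
    refine ((hc.integrableOn_compact hcomp).mono_set subset_closure).congr_fun (fun x hx => ?_) hmΩ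
    simp only [(hmain x hx).2, gradientWithin_eq_gradient (hnhds x hx)]
  have hdivthm := integral_divergence_eq_integral_frontier hΩ hFc (fun x hx => (hmain x hx).1) hdivF
  rw [setIntegral_congr_fun hmΩ fun x hx => (hmain x hx).2] at hdivthm
  rw [hdivthm, ← integral_const_mul]
  refine setIntegral_congr_fun isClosed_frontier.measurableSet fun x hx => ?_
  obtain ⟨c, hc⟩ := exists_gradientWithin_eq_smul_normal hΩ
    (hu1.differentiableOn (by simp)) hu0 hx
  have hν := norm_outwardUnitNormal hΩ hx
  have hPx : P x = 0 := by
    simp [hP, nonlinearPrimitive, hu0 x hx, Real.zero_rpow (show r ≠ 0 by positivity),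
      Real.zero_rpow (show q + 1 ≠ 0 by positivity)]
  simp only [hF, hPx, hu0 x hx]
  rw [hW, hc, norm_smul, hν, inner_add_left, inner_smul_left, inner_smul_left, inner_smul_left,
    inner_smul_right, real_inner_self_eq_norm_sq, hν]
  simp only [RCLike.conj_to_real, Real.norm_eq_abs, mul_one, sq_abs]
  ring
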